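/- Let A^(0), A^(1) ∈ (0,∞)^E, let μ_s := μ_{v0,A^(s)}, and let P_s^(T) be the ERRW trajectory law on V^{T+1} with initial weights A^(s), for s ∈ {0,1}. Define Gap_T := D(μ_0 ‖ μ_1) − D(P_0^(T) ‖ P_1^(T)). For a path with undirected edge-count vector N = (N_e)_{e∈E}, write d_v(N) := Σ_{e∋v} N_e, let x_T(N) denote the endpoint of the path (which is determined by N via the parity rule), and set b_v^{(s,N)} := (a_v^(s) + d_v(N) + 1 − 𝟙(v = x_T(N)))/2 where a_v^(s) := Σ_{e∋v} a_e^(s). Then for every T ≥ 1, Gap_T = E_{P_0^(T)}[ Σ_{e∈E} Λ(a_e^(0)+N_e, a_e^(1)+N_e) − Σ_{v∈V} Λ(b_v^{(0,N)}, b_v^{(1,N)}) ]. -/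

import Mathlib

open MeasureTheory Real Filter
open scoped ENNReal NNReal Classical BigOperators

noncomputable section

namespace ERRW

variable {V : Type*} [Fintype V] [DecidableEq V]

/-- Total weight at a vertex: sum of the edge weights over the edges incident to `i`. -/
def vw (G : SimpleGraph V) [DecidableRel G.Adj] (w : Sym2 V → ℝ) (i : V) : ℝ :=
  ∑ j ∈ G.neighborFinset i, w s(i, j)

/-- Product of a vertex function over the two endpoints of an unordered pair. -/
def sprod (f : V → ℝ) : Sym2 V → ℝ :=
  Sym2.lift ⟨fun i j => f i * f j, fun i j => mul_comm _ _⟩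

/-- Sum of a vertex function over the two endpoints of an unordered pair. -/
def ssum (f : V → ℝ) : Sym2 V → ℝ :=
  Sym2.lift ⟨fun i j => f i + f j, fun i j => add_comm _ _⟩

/-- Quenched transition probability `p_{ij}(w) = w_{ij}/w_i`. -/
def qstep (G : SimpleGraph V) [DecidableRel G.Adj] (w : Sym2 V → ℝ) (i j : V) : ℝ :=
  if G.Adj i j then w s(i, j) / vw G w i else 0

/-- Stationary distribution `π_i(w) = w_i / Σ_v w_v` of the quenched chain. -/
def statDist (G : SimpleGraph V) [DecidableRel G.Adj] (w : Sym2 V → ℝ) (i : V) : ℝ :=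
  vw G w i / ∑ v : V, vw G w v

/-- Spanning trees of `G`, as edge sets. -/
def spanningTrees (G : SimpleGraph V) [DecidableRel G.Adj] : Finset (Finset (Sym2 V)) :=
  G.edgeFinset.powerset.filter fun F =>
    (SimpleGraph.fromEdgeSet (F : Set (Sym2 V))).IsTree

/-- Spanning-tree polynomial `τ(w) = Σ_{T} Π_{e ∈ T} w_e`. -/
def tau (G : SimpleGraph V) [DecidableRel G.Adj] (w : Sym2 V → ℝ) : ℝ :=
  ∑ F ∈ spanningTrees G, ∏ e ∈ F, w e

/-- Vertex parameter `b_v = (B_v + 1 - 𝟙(v = x))/2`. -/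
def bwt (G : SimpleGraph V) [DecidableRel G.Adj] (x : V) (B : Sym2 V → ℝ) (v : V) : ℝ :=
  (vw G B v + 1 - if v = x then 1 else 0) / 2

/-- The normalizing constant `Z_{x,B}` of the magic formula. -/
def Znorm (G : SimpleGraph V) [DecidableRel G.Adj] (x : V) (B : Sym2 V → ℝ) : ℝ :=
  ((∏ e ∈ G.edgeFinset, Real.Gamma (B e)) /
      ∏ v : V, Real.Gamma (bwt G x B v)) *
    Real.pi ^ (((Fintype.card V : ℝ) - 1) / 2) /
    2 ^ ((1 : ℝ) - (Fintype.card V : ℝ) + ∑ e ∈ G.edgeFinset, B e)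

/-- The magic-formula density of `μ_{x,B}` with respect to `Π_{e ≠ e0} dw_e`. -/
def magicDensity (G : SimpleGraph V) [DecidableRel G.Adj] (x : V) (B : Sym2 V → ℝ)
    (w : Sym2 V → ℝ) : ℝ :=
  (Znorm G x B)⁻¹ * (vw G w x) ^ ((1 : ℝ) / 2) *
      (∏ e ∈ G.edgeFinset, w e ^ (B e - 1)) /
      (∏ v : V, (vw G w v) ^ ((vw G B v + 1) / 2)) *
    Real.sqrt (tau G w)

/-- Coordinates indexed by the non-reference edges. -/
abbrev Epin (G : SimpleGraph V) [DecidableRel G.Adj] (e0 : Sym2 V) :=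
  {e : Sym2 V // e ∈ G.edgeFinset ∧ e ≠ e0}

/-- Extension of non-reference edge coordinates to a pinned environment (`w_{e0} = 1`). -/
def pinExt (G : SimpleGraph V) [DecidableRel G.Adj] (e0 : Sym2 V)
    (u : Epin G e0 → ℝ) : Sym2 V → ℝ :=
  fun e => if e = e0 then 1 else if h : e ∈ G.edgeFinset ∧ e ≠ e0 then u ⟨e, h⟩ else 0

/-- The mixing measure `μ_{x,B}` of the magic formula, as a measure on
environments pinned at the reference edge `e0`. -/
def mixing (G : SimpleGraph V) [DecidableRel G.Adj] (e0 : Sym2 V) (x : V) (B : Sym2 V → ℝ) :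
    Measure (Sym2 V → ℝ) :=
  Measure.map (pinExt G e0)
    ((volume : Measure (Epin G e0 → ℝ)).withDensity fun u =>
      ENNReal.ofReal
        (if ∀ e ∈ G.edgeFinset, 0 < pinExt G e0 u e then
          magicDensity G x B (pinExt G e0 u) else 0))

/-- Kullback–Leibler divergence (natural logarithm), `+∞` if `P` is not
absolutely continuous with respect to `Q`. -/
def KL {Ω : Type*} [MeasurableSpace Ω] (P Q : Measure Ω) : EReal :=
  if P ≪ Q then ((∫ x, Real.log (P.rnDeriv Q x).toReal ∂P : ℝ) : EReal) else ⊤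

/-- Edge local time (current edge weight) at time `t` along a path. -/
def localTime (a : Sym2 V → ℝ) (x : ℕ → V) (t : ℕ) (e : Sym2 V) : ℝ :=
  a e + ((Finset.range t).filter fun k => s(x k, x (k + 1)) = e).card

/-- One-step ERRW conditional probability at time `t` given the past of the path. -/
def errwStep (G : SimpleGraph V) [DecidableRel G.Adj] (a : Sym2 V → ℝ) (x : ℕ → V)
    (t : ℕ) : ℝ :=
  if G.Adj (x t) (x (t + 1)) then
    localTime a x t s(x t, x (t + 1)) /
      ∑ u ∈ G.neighborFinset (x t), localTime a x t s(x t, u)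
  else 0

/-- Extension of a finite path to ℕ (junk value `v0` beyond time `T`). -/
def extendPath {T : ℕ} (v0 : V) (x : Fin (T + 1) → V) : ℕ → V :=
  fun t => if h : t < T + 1 then x ⟨t, h⟩ else v0

/-- ERRW trajectory probability of a length-`T` path (the trajectory law mass function). -/
def errwProb (G : SimpleGraph V) [DecidableRel G.Adj] (v0 : V) (a : Sym2 V → ℝ) (T : ℕ)
    (x : Fin (T + 1) → V) : ℝ :=
  if x 0 = v0 then ∏ t ∈ Finset.range T, errwStep G a (extendPath v0 x) t else 0

/-- Undirected traversal count `N_e` of an edge along a finite path. -/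
def edgeCount {T : ℕ} (v0 : V) (x : Fin (T + 1) → V) (e : Sym2 V) : ℕ :=
  ((Finset.range T).filter fun k =>
    s(extendPath v0 x k, extendPath v0 x (k + 1)) = e).card

/-- Quenched path probability of a length-`T` path started at `v0`. -/
def quenchedProb (G : SimpleGraph V) [DecidableRel G.Adj] (v0 : V) (w : Sym2 V → ℝ) (T : ℕ)
    (x : Fin (T + 1) → V) : ℝ :=
  if x 0 = v0 then
    ∏ t ∈ Finset.range T, qstep G w (extendPath v0 x t) (extendPath v0 x (t + 1))
  else 0

/-- The measure on a finite type determined by a mass function. -/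
def discreteMeasure {Ω : Type*} [Fintype Ω] [MeasurableSpace Ω] (p : Ω → ℝ) : Measure Ω :=
  ∑ x : Ω, ENNReal.ofReal (p x) • Measure.dirac x

/-- Digamma function `Ψ = (log Γ)'`. -/
def digamma (x : ℝ) : ℝ := deriv (fun y => Real.log (Real.Gamma y)) x

/-- Trigamma function `Ψ₁ = Ψ'`. -/
def trigamma (x : ℝ) : ℝ := deriv digamma x

/-- `Λ(p,q) = log Γ(q) − log Γ(p) − (q−p)·Ψ(p)`. -/
def Lam (p q : ℝ) : ℝ :=
  Real.log (Real.Gamma q) - Real.log (Real.Gamma p) - (q - p) * digamma p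

section Entropy

/-! ### One-dimensional integrals -/

theorem lintegral_exp_neg_sq_div_two :
    ∫⁻ z : ℝ, ENNReal.ofReal (exp (-(z ^ 2 / 2))) = ENNReal.ofReal √(2 * π) := by
  have h := integral_gaussian (1 / 2)
  have hi := integrable_exp_neg_mul_sq (b := 1 / 2) (by norm_num)
  have e : (fun z : ℝ => exp (-(z ^ 2 / 2))) = fun z => exp (-(1 / 2) * z ^ 2) := by
    funext z; ring_nf
  rw [← ofReal_integral_eq_lintegral_ofReal (by rw [e]; exact hi)
    (Eventually.of_forall fun z => (exp_pos _).le), e, h]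
  congr 2
  ring

theorem lintegral_cosh_kernel {C : ℝ} (hC : 0 < C) :
    ∫⁻ s : ℝ, ENNReal.ofReal (√C * cosh (s / 2) * exp (-(C * (cosh s - 1)))) =
      ENNReal.ofReal √(2 * π) := by
  have hsC : 0 < √C := sqrt_pos.2 hC
  set f : ℝ → ℝ := fun s => 2 * √C * sinh (s / 2) with hf
  have hderiv : ∀ s ∈ Set.univ, HasDerivWithinAt f (√C * cosh (s / 2)) Set.univ s := by
    intro s _
    have h1 : HasDerivAt (fun s : ℝ => s / 2) (1 / 2) s := (hasDerivAt_id s).div_const 2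
    have h2 := (h1.sinh).const_mul (2 * √C)
    refine HasDerivAt.hasDerivWithinAt ?_
    exact h2.congr_deriv (by ring)
  have hinj : Set.InjOn f Set.univ := by
    intro a _ b _ hab
    have : sinh (a / 2) = sinh (b / 2) := mul_left_cancel₀ (by positivity) hab
    have := sinh_injective this
    linarith
  have himg : f '' Set.univ = Set.univ := by
    refine Set.eq_univ_of_forall fun y => ?_
    obtain ⟨x, hx⟩ := sinh_surjective (y / (2 * √C))
    refine ⟨2 * x, trivial, ?_⟩
    simp only [hf]
    rw [mul_div_cancel_left₀ x two_ne_zero, hx]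
    field_simp
  have key := lintegral_image_eq_lintegral_abs_deriv_mul MeasurableSet.univ hderiv hinj
    (fun z => ENNReal.ofReal (exp (-(z ^ 2 / 2))))
  rw [himg, Measure.restrict_univ, lintegral_exp_neg_sq_div_two] at key
  rw [key]
  refine lintegral_congr fun s => ?_
  have hc := cosh_pos (s / 2)
  rw [abs_of_pos (by positivity), ← ENNReal.ofReal_mul (by positivity)]
  congr 3
  have h1 : cosh s = 2 * sinh (s / 2) ^ 2 + 1 := by
    have := cosh_two_mul (s / 2)
    rw [cosh_sq] at this
    rw [← mul_div_cancel_left₀ s (two_ne_zero' ℝ), mul_div_assoc, this]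
    ring_nf
  simp only [hf]
  rw [h1, mul_pow, mul_pow, sq_sqrt hC.le]
  ring

/-- Normalization of the one-vertex kernel. -/
theorem lintegral_pivot {C : ℝ} (hC : 0 < C) :
    ∫⁻ t : ℝ, ENNReal.ofReal
        (exp (-(exp t / 2 - C + C ^ 2 / (2 * exp t))) * √(exp t)) =
      ENNReal.ofReal √(2 * π) := by
  set g : ℝ → ℝ≥0∞ := fun s =>
    ENNReal.ofReal (√C * exp (s / 2) * exp (-(C * (cosh s - 1)))) with hg
  have hshift : ∫⁻ t : ℝ, ENNReal.ofReal
        (exp (-(exp t / 2 - C + C ^ 2 / (2 * exp t))) * √(exp t)) = ∫⁻ s, g s := by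
    rw [← lintegral_add_left_eq_self _ (Real.log C)]
    refine lintegral_congr fun s => ?_
    simp only [hg]
    congr 1
    rw [exp_add, exp_log hC, sqrt_mul hC.le, sqrt_eq_rpow (exp s), ← exp_mul, cosh_eq, exp_neg s]
    rw [mul_comm, show s * (1 / 2) = s / 2 by ring]
    congr 2
    have := exp_pos s
    field_simp
    ring
  have hgm : Measurable g := by
    refine Measurable.ennreal_ofReal ?_
    have : Continuous fun s => √C * exp (s / 2) * exp (-(C * (cosh s - 1))) := by fun_prop
    exact this.measurable
  have hneg : ∫⁻ s, g (-s) = ∫⁻ s, g s := by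
    have := lintegral_sub_left_eq_self (μ := volume) g 0
    simpa using this
  have h2 : 2 * ∫⁻ s, g s = 2 * ENNReal.ofReal √(2 * π) := by
    rw [two_mul]
    nth_rewrite 2 [← hneg]
    rw [← lintegral_add_left hgm, ← lintegral_cosh_kernel hC,
      ← lintegral_const_mul' 2 _ (by simp)]
    refine lintegral_congr fun s => ?_
    simp only [hg]
    rw [← ENNReal.ofReal_add (by positivity) (by positivity), cosh_neg,
      show (2 : ℝ≥0∞) = ENNReal.ofReal 2 by simp, ← ENNReal.ofReal_mul (by norm_num),
      cosh_eq (s / 2), neg_div]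
    congr 1
    ring
  rw [hshift]
  exact (ENNReal.mul_right_inj (by simp) (by simp)).1 h2

/-- Gamma integral in exponential coordinates. -/
theorem lintegral_exp_gamma {k a c : ℝ} (hk : k ≠ 0) (ha : 0 < a) (hc : 0 < c) :
    ∫⁻ t : ℝ, ENNReal.ofReal (exp (k * a * t - c * exp (k * t))) =
      ENNReal.ofReal (|k|⁻¹ * (Gamma a * c ^ (-a))) := by
  have hderiv : ∀ s ∈ Set.univ,
      HasDerivWithinAt (fun t => exp (k * t)) (exp (k * s) * k) Set.univ s := by
    intro s _
    have h1 : HasDerivAt (fun s : ℝ => k * s) k s := by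
      simpa using (hasDerivAt_id s).const_mul k
    exact h1.exp.hasDerivWithinAt
  have hinj : Set.InjOn (fun t => exp (k * t)) Set.univ := fun a _ b _ hab =>
    mul_left_cancel₀ hk (exp_injective hab)
  have himg : (fun t => exp (k * t)) '' Set.univ = Set.Ioi 0 := by
    ext y
    constructor
    · rintro ⟨t, -, rfl⟩
      exact exp_pos _
    · intro hy
      refine ⟨Real.log y / k, trivial, ?_⟩
      simp only
      rw [mul_div_cancel₀ _ hk, exp_log hy]
  have key := lintegral_image_eq_lintegral_abs_deriv_mul MeasurableSet.univ hderiv hinj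
    (fun z => ENNReal.ofReal (z ^ (a - 1) * exp (-(c * z))))
  have hint : IntegrableOn (fun z : ℝ => z ^ (a - 1) * exp (-(c * z))) (Set.Ioi 0) := by
    have := integrableOn_rpow_mul_exp_neg_mul_rpow (s := a - 1) (p := 1) (b := c)
      (by linarith) one_pos hc
    simpa using this
  rw [himg, Measure.restrict_univ,
    ← ofReal_integral_eq_lintegral_ofReal hint
      ((ae_restrict_iff' measurableSet_Ioi).2 (Eventually.of_forall fun z hz =>
        mul_nonneg (rpow_nonneg (le_of_lt hz) _) (exp_pos _).le)),
    integral_rpow_mul_exp_neg_mul_Ioi ha hc] at key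
  have hfin : ENNReal.ofReal |k| * ∫⁻ t : ℝ, ENNReal.ofReal (exp (k * a * t - c * exp (k * t))) =
      ENNReal.ofReal ((1 / c) ^ a * Gamma a) := by
    rw [key, ← lintegral_const_mul' _ _ ENNReal.ofReal_ne_top]
    refine lintegral_congr fun t => ?_
    rw [← ENNReal.ofReal_mul (abs_nonneg _), ← ENNReal.ofReal_mul (abs_nonneg _)]
    congr 1
    rw [abs_mul, abs_of_pos (exp_pos _), ← exp_mul, mul_comm (exp (k * t)) |k|, mul_assoc |k|, ← exp_add,
      ← exp_add]
    congr 2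
    ring
  have hk' : ENNReal.ofReal |k| ≠ 0 := by simpa using hk
  refine (ENNReal.mul_right_inj hk' ENNReal.ofReal_ne_top).1 ?_
  rw [hfin, ← ENNReal.ofReal_mul (abs_nonneg _), ← mul_assoc,
    mul_inv_cancel₀ (abs_ne_zero.2 hk), one_mul, one_div, inv_rpow hc.le, rpow_neg hc.le, mul_comm]

/-! ### Normalization of the vertex-reinforced jump process density -/

/-- Energy of a log-field `u` with conductances `W` and boundary conductances `η`. -/
def vrjpEnergy {ι : Type*} [Fintype ι] (W : ι → ι → ℝ) (η u : ι → ℝ) : ℝ :=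
  1 / 2 * ∑ i, ∑ j, W i j * (cosh (u i - u j) - 1) + ∑ i, η i * (cosh (u i) - 1)

/-- Random Schrödinger matrix associated with a log-field `u`. -/
def vrjpMatrix {ι : Type*} [Fintype ι] (W : ι → ι → ℝ) (η u : ι → ℝ) : Matrix ι ι ℝ :=
  Matrix.of fun i j =>
    (if i = j then (∑ k, W i k * exp (u k) + η i) / exp (u i) else 0) - W i j

/-- Conductances after elimination of the vertex `0` with pivot `y`. -/
def elimW {n : ℕ} (W : Fin (n + 1) → Fin (n + 1) → ℝ) (y : ℝ) (i j : Fin n) : ℝ :=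
  W i.succ j.succ + W 0 i.succ * W 0 j.succ / y

/-- Boundary conductances after elimination of the vertex `0` with pivot `y`. -/
def elimEta {n : ℕ} (W : Fin (n + 1) → Fin (n + 1) → ℝ) (η : Fin (n + 1) → ℝ) (y : ℝ)
    (i : Fin n) : ℝ :=
  η i.succ + W 0 i.succ * η 0 / y

/-- Every set of vertices is connected to its complement or to the boundary. -/
def Escapes {ι : Type*} (W : ι → ι → ℝ) (η : ι → ℝ) : Prop :=
  ∀ S : Set ι, S.Nonempty → ∃ i ∈ S, 0 < η i ∨ ∃ j ∉ S, 0 < W i j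

theorem Escapes.elim {n : ℕ} {W : Fin (n + 1) → Fin (n + 1) → ℝ} {η : Fin (n + 1) → ℝ}
    (hsymm : ∀ i j, W i j = W j i) (hW : ∀ i j, 0 ≤ W i j) (hη : ∀ i, 0 ≤ η i)
    (h : Escapes W η) {y : ℝ} (hy : 0 < y) : Escapes (elimW W y) (elimEta W η y) := by
  intro S hS
  have hηle : ∀ i, 0 < η (Fin.succ i) → 0 < elimEta W η y i := fun i hi =>
    add_pos_of_pos_of_nonneg hi (div_nonneg (mul_nonneg (hW _ _) (hη _)) hy.le)
  have hWle : ∀ i j, 0 < W (Fin.succ i) (Fin.succ j) → 0 < elimW W y i j := fun i j hi =>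
    add_pos_of_pos_of_nonneg hi (div_nonneg (mul_nonneg (hW _ _) (hW _ _)) hy.le)
  obtain ⟨_, ⟨i, hi, rfl⟩, h1⟩ := h (Fin.succ '' S) (hS.image _)
  rcases h1 with h1 | ⟨j, hj, hij⟩
  · exact ⟨i, hi, Or.inl (hηle i h1)⟩
  cases j using Fin.cases with
  | succ j => exact ⟨i, hi, Or.inr ⟨j, fun hj' => hj ⟨j, hj', rfl⟩, hWle i j hij⟩⟩
  | zero =>
    have h0i : 0 < W 0 i.succ := by rwa [hsymm]
    obtain ⟨k, hk, h2⟩ := h (insert 0 (Fin.succ '' S)) (Set.insert_nonempty _ _)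
    rcases hk with rfl | ⟨k, hk, rfl⟩
    · rcases h2 with h2 | ⟨j, hj, h0j⟩
      · exact ⟨i, hi, Or.inl (add_pos_of_nonneg_of_pos (hη _) (by positivity))⟩
      · cases j using Fin.cases with
        | zero => exact absurd (Set.mem_insert _ _) hj
        | succ j =>
          exact ⟨i, hi, Or.inr ⟨j, fun hj' => hj (Set.mem_insert_of_mem _ ⟨j, hj', rfl⟩),
            add_pos_of_nonneg_of_pos (hW _ _) (by positivity)⟩⟩
    · rcases h2 with h2 | ⟨j, hj, hkj⟩
      · exact ⟨k, hk, Or.inl (hηle k h2)⟩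
      · cases j using Fin.cases with
        | zero => exact absurd (Set.mem_insert _ _) hj
        | succ j =>
          exact ⟨k, hk, Or.inr ⟨j, fun hj' => hj (Set.mem_insert_of_mem _ ⟨j, hj', rfl⟩),
            hWle k j hkj⟩⟩

/-- The value of the eliminated coordinate in terms of the pivot `exp t`. -/
def elimCoord {n : ℕ} (W : Fin (n + 1) → Fin (n + 1) → ℝ) (η : Fin (n + 1) → ℝ)
    (u : Fin n → ℝ) : ℝ :=
  Real.log (∑ j : Fin n, W 0 j.succ * exp (u j) + η 0)

theorem vrjpEnergy_cons {n : ℕ} {W : Fin (n + 1) → Fin (n + 1) → ℝ} {η : Fin (n + 1) → ℝ}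
    (hsymm : ∀ i j, W i j = W j i) (u : Fin n → ℝ)
    (hc : 0 < ∑ j : Fin n, W 0 j.succ * exp (u j) + η 0) (t : ℝ) :
    vrjpEnergy W η (Fin.cons (elimCoord W η u - t) u) =
      (exp t / 2 - (∑ j : Fin n, W 0 j.succ + η 0) +
        (∑ j : Fin n, W 0 j.succ + η 0) ^ 2 / (2 * exp t)) +
      vrjpEnergy (elimW W (exp t)) (elimEta W η (exp t)) u := by
  have ht := exp_pos t
  set P := ∑ j : Fin n, W 0 j.succ * exp (u j) with hP
  set Q := ∑ j : Fin n, W 0 j.succ * exp (-u j) with hQ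
  set R := ∑ j : Fin n, W 0 j.succ with hR
  have he : exp (elimCoord W η u - t) = (P + η 0) / exp t := by
    rw [exp_sub, elimCoord, exp_log hc]
  have he' : exp (-(elimCoord W η u - t)) = exp t / (P + η 0) := by
    rw [exp_neg, he, inv_div]
  have hrow : ∑ j : Fin n, W 0 j.succ * (cosh (elimCoord W η u - t - u j) - 1) =
      ((P + η 0) / exp t * Q + exp t / (P + η 0) * P) / 2 - R := by
    rw [hP, hQ, hR, Finset.mul_sum, Finset.mul_sum, ← Finset.sum_add_distrib, Finset.sum_div,
      ← Finset.sum_sub_distrib]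
    refine Finset.sum_congr rfl fun j _ => ?_
    rw [cosh_eq, sub_eq_add_neg _ (u j), neg_add, neg_neg, exp_add, exp_add, he, he']
    ring
  have hcol : ∑ j : Fin n, W j.succ 0 * (cosh (u j - (elimCoord W η u - t)) - 1) =
      ((P + η 0) / exp t * Q + exp t / (P + η 0) * P) / 2 - R := by
    rw [← hrow]
    refine Finset.sum_congr rfl fun j _ => ?_
    rw [hsymm, ← cosh_neg, neg_sub]
  have hEta : ∑ i : Fin n, elimEta W η (exp t) i * (cosh (u i) - 1) =
      ∑ i : Fin n, η i.succ * (cosh (u i) - 1) + η 0 / exp t * ((P + Q) / 2 - R) := by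
    rw [hP, hQ, hR, ← Finset.sum_add_distrib, Finset.sum_div, ← Finset.sum_sub_distrib,
      Finset.mul_sum, ← Finset.sum_add_distrib]
    refine Finset.sum_congr rfl fun j _ => ?_
    rw [elimEta, cosh_eq]
    ring
  have hWW : ∑ i : Fin n, ∑ j : Fin n, elimW W (exp t) i j * (cosh (u i - u j) - 1) =
      ∑ i : Fin n, ∑ j : Fin n, W i.succ j.succ * (cosh (u i - u j) - 1) +
        (P * Q - R * R) / exp t := by
    have h1 : P * Q - R * R = (P * Q + Q * P) / 2 - R * R := by ring
    rw [h1, hP, hQ, hR, Finset.sum_mul_sum, Finset.sum_mul_sum, Finset.sum_mul_sum,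
      ← Finset.sum_add_distrib, Finset.sum_div, ← Finset.sum_sub_distrib, Finset.sum_div,
      ← Finset.sum_add_distrib]
    refine Finset.sum_congr rfl fun i _ => ?_
    rw [← Finset.sum_add_distrib, Finset.sum_div, ← Finset.sum_sub_distrib, Finset.sum_div,
      ← Finset.sum_add_distrib]
    refine Finset.sum_congr rfl fun j _ => ?_
    rw [elimW, cosh_eq, sub_eq_add_neg (u i), neg_add, neg_neg, exp_add, exp_add]
    ring
  unfold vrjpEnergy
  rw [hEta, hWW]
  simp only [Fin.sum_univ_succ, Fin.cons_zero, Fin.cons_succ, Finset.sum_add_distrib]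
  rw [hrow, hcol, cosh_eq (elimCoord W η u - t), he, he']
  simp only [sub_self, cosh_zero, mul_zero, zero_add]
  field_simp
  ring

theorem det_vrjpMatrix_cons {n : ℕ} {W : Fin (n + 1) → Fin (n + 1) → ℝ} {η : Fin (n + 1) → ℝ}
    (hsymm : ∀ i j, W i j = W j i) (u : Fin n → ℝ)
    (hc : 0 < ∑ j : Fin n, W 0 j.succ * exp (u j) + η 0) (t : ℝ) :
    (vrjpMatrix W η (Fin.cons (elimCoord W η u - t) u)).det =
      exp t * (vrjpMatrix (elimW W (exp t)) (elimEta W η (exp t)) u).det := by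
  have ht := exp_pos t
  set P := ∑ j : Fin n, W 0 j.succ * exp (u j) with hP
  have he : exp (elimCoord W η u - t) = (P + η 0) / exp t := by
    rw [exp_sub, elimCoord, exp_log hc]
  set A := vrjpMatrix W η (Fin.cons (elimCoord W η u - t) u) with hA
  have h00 : A 0 0 = exp t := by
    simp only [hA, vrjpMatrix, Matrix.of_apply, Fin.sum_univ_succ, Fin.cons_zero, Fin.cons_succ,
      if_true]
    rw [← hP, he]
    field_simp
    ring
  have h0s : ∀ j : Fin n, A 0 j.succ = -W 0 j.succ := by
    intro j
    simp [hA, vrjpMatrix, (Fin.succ_ne_zero j).symm]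
  have hs0 : ∀ j : Fin n, A j.succ 0 = -W 0 j.succ := by
    intro j
    simp [hA, vrjpMatrix, hsymm 0]
  set c : Fin (n + 1) → ℝ := Fin.cons 0 fun i => -W 0 i.succ / exp t with hcdef
  set B : Matrix (Fin (n + 1)) (Fin (n + 1)) ℝ := Matrix.of fun i j => A i j - c i * A 0 j with hB
  have hdet : A.det = B.det := by
    refine Matrix.det_eq_of_forall_row_eq_smul_add_const c 0 (by simp [hcdef]) fun i j => ?_
    simp [hB, hcdef]
  have hB0 : ∀ i : Fin n, B i.succ 0 = 0 := by
    intro i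
    simp only [hB, hcdef, Matrix.of_apply, Fin.cons_succ, hs0, h00]
    field_simp
    ring
  rw [hdet, Matrix.det_succ_column_zero, Fin.sum_univ_succ]
  simp only [hB0, mul_zero, zero_mul, Finset.sum_const_zero, add_zero]
  have hB00 : B 0 0 = exp t := by simp [hB, hcdef, h00]
  rw [hB00]
  simp only [Fin.val_zero, pow_zero, one_mul]
  congr 2
  ext i j
  simp only [Matrix.submatrix_apply, Fin.succAbove_zero, hB, hcdef, Matrix.of_apply, Fin.cons_succ,
    h0s]
  simp only [hA, vrjpMatrix, Matrix.of_apply, Fin.cons_succ, Fin.succ_inj, Fin.sum_univ_succ,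
    Fin.cons_zero, elimW, elimEta]
  rw [he]
  by_cases hij : i = j
  · subst hij
    simp only [if_true]
    have : ∑ k : Fin n, (W i.succ k.succ + W 0 i.succ * W 0 k.succ / exp t) * exp (u k) =
        ∑ k : Fin n, W i.succ k.succ * exp (u k) + W 0 i.succ / exp t * P := by
      rw [hP, Finset.mul_sum, ← Finset.sum_add_distrib]
      refine Finset.sum_congr rfl fun k _ => ?_
      ring
    rw [this, hsymm i.succ 0]
    ring
  · simp only [hij, if_false]
    ring

theorem lintegral_vrjp_fin : ∀ (n : ℕ) (W : Fin n → Fin n → ℝ) (η : Fin n → ℝ),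
    (∀ i j, W i j = W j i) → (∀ i j, 0 ≤ W i j) → (∀ i, 0 ≤ η i) → Escapes W η →
    ∫⁻ u : Fin n → ℝ, ENNReal.ofReal (exp (-vrjpEnergy W η u) * √(vrjpMatrix W η u).det) =
      ENNReal.ofReal √(2 * π) ^ n := by
  intro n
  induction n with
  | zero =>
    intro W η _ _ _ _
    simp [vrjpEnergy, volume_pi]
  | succ n ih =>
    intro W η hsymm hW hη hesc
    have hrow : 0 < η 0 ∨ ∃ j : Fin n, 0 < W 0 j.succ := by
      obtain ⟨i, hi, h⟩ := hesc {0} (Set.singleton_nonempty _)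
      rw [Set.mem_singleton_iff] at hi
      subst hi
      refine h.imp id ?_
      rintro ⟨j, hj, hij⟩
      cases j using Fin.cases with
      | zero => exact absurd rfl hj
      | succ j => exact ⟨j, hij⟩
    have hc : ∀ f : Fin n → ℝ, (∀ j, 0 < f j) → 0 < ∑ j : Fin n, W 0 j.succ * f j + η 0 := by
      intro f hf
      rcases hrow with h | ⟨j, hj⟩
      · exact add_pos_of_nonneg_of_pos
          (Finset.sum_nonneg fun j _ => mul_nonneg (hW _ _) (hf j).le) h
      · exact add_pos_of_pos_of_nonneg
          (Finset.sum_pos' (fun j _ => mul_nonneg (hW _ _) (hf j).le)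
            ⟨j, Finset.mem_univ _, mul_pos hj (hf j)⟩) (hη 0)
    have hC : 0 < ∑ j : Fin n, W 0 j.succ + η 0 := by simpa using hc (fun _ => 1) (by simp)
    set F : (Fin (n + 1) → ℝ) → ℝ≥0∞ := fun u =>
      ENNReal.ofReal (exp (-vrjpEnergy W η u) * √(vrjpMatrix W η u).det) with hF
    have hFm : Measurable F := by
      refine Measurable.ennreal_ofReal (Continuous.measurable ?_)
      unfold vrjpEnergy
      refine Continuous.mul (by fun_prop) (Continuous.sqrt (Continuous.matrix_det ?_))
      refine continuous_matrix fun i j => ?_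
      simp only [vrjpMatrix, Matrix.of_apply]
      refine Continuous.sub ?_ continuous_const
      split_ifs
      · exact Continuous.div (by fun_prop) (by fun_prop) fun u => (exp_pos _).ne'
      · exact continuous_const
    set K : ℝ → (Fin n → ℝ) → ℝ≥0∞ := fun t u =>
      ENNReal.ofReal (exp (-vrjpEnergy (elimW W (exp t)) (elimEta W η (exp t)) u) *
        √(vrjpMatrix (elimW W (exp t)) (elimEta W η (exp t)) u).det) with hK
    set k : ℝ → ℝ≥0∞ := fun t => ENNReal.ofReal
      (exp (-(exp t / 2 - (∑ j : Fin n, W 0 j.succ + η 0) +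
        (∑ j : Fin n, W 0 j.succ + η 0) ^ 2 / (2 * exp t))) * √(exp t)) with hk
    have hkm : Measurable k := by
      refine Measurable.ennreal_ofReal (Continuous.measurable ?_)
      have : ∀ t : ℝ, 2 * exp t ≠ 0 := fun t => by positivity
      fun_prop (disch := assumption)
    have hKm : Measurable (Function.uncurry K) := by
      refine Measurable.ennreal_ofReal (Continuous.measurable ?_)
      have hne : ∀ p : ℝ × (Fin n → ℝ), exp p.1 ≠ 0 := fun p => (exp_pos _).ne'
      have hWc : ∀ i j, Continuous fun p : ℝ × (Fin n → ℝ) => elimW W (exp p.1) i j := by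
        intro i j
        unfold elimW
        fun_prop (disch := assumption)
      have hηc : ∀ i, Continuous fun p : ℝ × (Fin n → ℝ) => elimEta W η (exp p.1) i := by
        intro i
        unfold elimEta
        fun_prop (disch := assumption)
      unfold vrjpEnergy
      refine Continuous.mul (by fun_prop) (Continuous.sqrt (Continuous.matrix_det ?_))
      refine continuous_matrix fun i j => ?_
      simp only [vrjpMatrix, Matrix.of_apply]
      refine Continuous.sub ?_ (hWc i j)
      split_ifs
      · exact Continuous.div (by fun_prop) (by fun_prop) fun u => (exp_pos _).ne'
      · exact continuous_const
    have hsplit : ∀ (t : ℝ) (u : Fin n → ℝ),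
        F (Fin.cons (elimCoord W η u - t) u) = k t * K t u := by
      intro t u
      simp only [hF, hk, hK]
      rw [← ENNReal.ofReal_mul (by positivity), vrjpEnergy_cons hsymm u (hc _ fun j => exp_pos _),
        det_vrjpMatrix_cons hsymm u (hc _ fun j => exp_pos _), sqrt_mul (exp_pos t).le, neg_add,
        exp_add]
      congr 1
      ring
    have hcons : Measurable fun p : ℝ × (Fin n → ℝ) => (Fin.cons p.1 p.2 : Fin (n + 1) → ℝ) := by
      refine measurable_pi_lambda _ fun i => ?_
      cases i using Fin.cases with
      | zero => simpa using measurable_fst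
      | succ i => exact (measurable_pi_apply i).comp measurable_snd
    have hstep : ∫⁻ u, F u = ∫⁻ p : ℝ × (Fin n → ℝ), F (Fin.cons p.1 p.2) := by
      rw [← (volume_preserving_piFinSuccAbove (fun _ : Fin (n + 1) => ℝ) 0).symm.lintegral_comp hFm]
      refine lintegral_congr fun p => ?_
      simp [MeasurableEquiv.piFinSuccAbove, Fin.insertNthEquiv]
    rw [hstep, Measure.volume_eq_prod, lintegral_prod_symm (fun p => F (Fin.cons p.1 p.2))
      (hFm.comp hcons).aemeasurable]
    have hsub : ∀ u : Fin n → ℝ, ∫⁻ x : ℝ, F (Fin.cons x u) = ∫⁻ t : ℝ, k t * K t u := by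
      intro u
      rw [← lintegral_sub_left_eq_self (fun x : ℝ => F (Fin.cons x u)) (elimCoord W η u)]
      exact lintegral_congr fun t => hsplit t u
    simp only [hsub]
    rw [lintegral_lintegral_swap]
    · have hin : ∀ t : ℝ, ∫⁻ u : Fin n → ℝ, k t * K t u =
          k t * ENNReal.ofReal √(2 * π) ^ n := by
        intro t
        rw [lintegral_const_mul' _ _ ENNReal.ofReal_ne_top, hK]
        congr 1
        refine ih _ _ (fun i j => ?_) (fun i j => ?_) (fun i => ?_)
          (hesc.elim hsymm hW hη (exp_pos t))
        · simp only [elimW]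
          rw [hsymm]
          ring
        · exact add_nonneg (hW _ _)
            (div_nonneg (mul_nonneg (hW _ _) (hW _ _)) (exp_pos t).le)
        · exact add_nonneg (hη _)
            (div_nonneg (mul_nonneg (hW _ _) (hη _)) (exp_pos t).le)
      simp only [hin]
      rw [lintegral_mul_const _ hkm, hk, lintegral_pivot hC, pow_succ']
    · clear_value K k
      have h1 : Measurable fun p : (Fin n → ℝ) × ℝ => Function.uncurry K p.swap :=
        hKm.comp measurable_swap
      exact ((hkm.comp measurable_snd).mul h1).aemeasurable

/-- The density of the vertex-reinforced jump process mixing field is normalized. -/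
theorem lintegral_vrjp {ι : Type*} [Fintype ι] (W : ι → ι → ℝ) (η : ι → ℝ)
    (hsymm : ∀ i j, W i j = W j i) (hW : ∀ i j, 0 ≤ W i j) (hη : ∀ i, 0 ≤ η i)
    (hesc : Escapes W η) :
    ∫⁻ u : ι → ℝ, ENNReal.ofReal (exp (-vrjpEnergy W η u) * √(vrjpMatrix W η u).det) =
      ENNReal.ofReal √(2 * π) ^ Fintype.card ι := by
  set e : Fin (Fintype.card ι) ≃ ι := (Fintype.equivFin ι).symm with he
  rw [← lintegral_vrjp_fin (Fintype.card ι) (fun i j => W (e i) (e j)) (fun i => η (e i))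
    (fun i j => hsymm _ _) (fun i j => hW _ _) (fun i => hη _) ?_]
  · rw [← (volume_measurePreserving_piCongrLeft (fun _ : ι => ℝ) e).lintegral_comp_emb
      (MeasurableEquiv.measurableEmbedding _)]
    refine lintegral_congr fun u => ?_
    have hu : ∀ i, (MeasurableEquiv.piCongrLeft (fun _ : ι => ℝ) e) u (e i) = u i := fun i => by
      simp [MeasurableEquiv.coe_piCongrLeft, Equiv.piCongrLeft_apply_apply]
    congr 3
    · unfold vrjpEnergy
      simp only [← Equiv.sum_comp e, hu]
    · rw [← Matrix.det_submatrix_equiv_self e]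
      congr 2
      ext i j
      simp only [vrjpMatrix, Matrix.submatrix_apply, Matrix.of_apply, e.injective.eq_iff, hu]
      simp only [← Equiv.sum_comp e, hu]
  · intro S hS
    obtain ⟨_, ⟨i, hi, rfl⟩, h⟩ := hesc (e '' S) (hS.image _)
    refine ⟨i, hi, h.imp id ?_⟩
    rintro ⟨j, hj, hij⟩
    refine ⟨e.symm j, fun hS => hj ⟨_, hS, by simp⟩, by simpa using hij⟩

/-! ### The matrix-tree theorem -/

/-- The Laplacian of `G` with edge weights `w`, reduced at the vertex `x`. -/
def reducedLaplacian (G : SimpleGraph V) [DecidableRel G.Adj] (w : Sym2 V → ℝ) (x : V) :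
    Matrix {v // v ≠ x} {v // v ≠ x} ℝ :=
  Matrix.of fun i j =>
    (if i = j then vw G w i else 0) - if G.Adj i j then w s((i : V), (j : V)) else 0

/-- A parent function whose iterates all lead to the root `x`. -/
def LeadsToRoot {x : V} (r : {v // v ≠ x} → V) : Prop :=
  ∃ d : V → ℕ, ∀ i, d (r i) < d i

/-- The matrix `1 - P`, where `P` is the transition matrix of a parent function. -/
def parentMatrix {x : V} (r : {v // v ≠ x} → V) : Matrix {v // v ≠ x} {v // v ≠ x} ℝ :=
  Matrix.of fun i j => (if i = j then 1 else 0) - if r i = j then 1 else 0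

theorem det_parentMatrix_of_leadsToRoot {x : V} {r : {v // v ≠ x} → V} (h : LeadsToRoot r) :
    (parentMatrix r).det = 1 := by
  obtain ⟨d, hd⟩ := h
  have htri : (parentMatrix r).BlockTriangular fun i => OrderDual.toDual (d i) := by
    intro i j hij
    have hij' : d i < d j := hij
    have h1 : i ≠ j := fun h => by simp [h] at hij'
    have h2 : r i ≠ j := fun h => by
      have := hd i
      rw [h] at this
      omega
    simp [parentMatrix, h1, h2]
  rw [htri.det]
  refine Finset.prod_eq_one fun k _ => ?_
  suffices h1 : (parentMatrix r).toSquareBlock (fun i => OrderDual.toDual (d i)) k = 1 by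
    rw [h1, Matrix.det_one]
  ext ⟨i, hi⟩ ⟨j, hj⟩
  have h2 : r i ≠ j := fun h => by
    have := hd i
    rw [h] at this
    have h3 : d i = d j := OrderDual.toDual.injective (hi.trans hj.symm)
    omega
  simp [parentMatrix, Matrix.toSquareBlock, Matrix.toSquareBlockProp, h2, Matrix.one_apply]

theorem det_parentMatrix_of_not_leadsToRoot {x : V} {r : {v // v ≠ x} → V}
    (h : ¬ LeadsToRoot r) : (parentMatrix r).det = 0 := by
  set f : V → V := fun v => if hv : v ≠ x then r ⟨v, hv⟩ else x with hf
  have hfi : ∀ i : {v // v ≠ x}, f i = r i := fun i => by simp [hf, i.2]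
  by_cases hall : ∀ v, ∃ k, f^[k] v = x
  · refine absurd ⟨fun v => Nat.find (hall v), fun i => ?_⟩ h
    have hs := Nat.find_spec (hall i)
    have hpos : Nat.find (hall i) ≠ 0 := by
      intro h0
      rw [h0] at hs
      exact i.2 hs
    obtain ⟨k, hk⟩ := Nat.exists_eq_succ_of_ne_zero hpos
    rw [hk, Function.iterate_succ_apply, hfi] at hs
    change Nat.find (hall (r i)) < Nat.find (hall i)
    have := Nat.find_min' (hall (r i)) hs
    omega
  · push Not at hall
    obtain ⟨v, hv⟩ := hall
    refine Matrix.exists_mulVec_eq_zero_iff.1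
      ⟨fun i => if ∀ k, f^[k] i ≠ x then 1 else 0, ?_, ?_⟩
    · intro h0
      have := congrFun h0 ⟨v, hv 0⟩
      simp [hv] at this
    · ext i
      have hiff : (∀ k, f^[k] (r i) ≠ x) ↔ ∀ k, f^[k] i ≠ x := by
        refine ⟨fun hk k => ?_, fun hk k => ?_⟩
        · cases k with
          | zero => exact i.2
          | succ k => rw [Function.iterate_succ_apply, hfi]; exact hk k
        · have := hk (k + 1)
          rwa [Function.iterate_succ_apply, hfi] at this
      simp only [Matrix.mulVec, dotProduct, parentMatrix, Matrix.of_apply, sub_mul,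
        Finset.sum_sub_distrib, ite_mul, one_mul, zero_mul, Finset.sum_ite_eq, Finset.mem_univ,
        if_true, Pi.zero_apply]
      by_cases hx : r i = x
      · have h1 : ¬ ∀ k, f^[k] i ≠ x := fun hk => hk 1 (by simpa [hfi] using hx)
        rw [if_neg h1, zero_sub, neg_eq_zero]
        refine Finset.sum_eq_zero fun j _ => if_neg fun hj => j.2 (hj.symm.trans hx)
      · rw [Finset.sum_eq_single ⟨r i, hx⟩]
        · simp only [if_true, hiff, sub_self]
        · intro j _ hj
          exact if_neg fun h => hj (Subtype.ext h.symm)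
        · simp

theorem det_reducedLaplacian_eq_sum (G : SimpleGraph V) [DecidableRel G.Adj] (w : Sym2 V → ℝ)
    (x : V) :
    (reducedLaplacian G w x).det =
      ∑ r ∈ Fintype.piFinset (fun i : {v // v ≠ x} => G.neighborFinset (i : V)) with LeadsToRoot r,
        ∏ i : {v // v ≠ x}, w s((i : V), r i) := by
  have hrow : reducedLaplacian G w x = fun i : {v // v ≠ x} =>
      ∑ j ∈ G.neighborFinset (i : V), (w s((i : V), j)) •
        fun k : {v // v ≠ x} => ((if i = k then 1 else 0) - if j = k then 1 else 0 : ℝ) := by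
    ext i k
    simp only [reducedLaplacian, Matrix.of_apply, Finset.sum_apply, Pi.smul_apply, smul_eq_mul,
      mul_sub, Finset.sum_sub_distrib, mul_ite, mul_one, mul_zero]
    congr 1
    · split_ifs <;> simp [vw]
    · simp [Finset.sum_ite_eq']
  have hmulti := (Matrix.detRowAlternating (n := {v // v ≠ x}) (R := ℝ)).toMultilinearMap.map_sum_finset
    (fun (i : {v // v ≠ x}) (j : V) => (w s((i : V), j)) •
        fun k : {v // v ≠ x} => ((if i = k then 1 else 0) - if j = k then 1 else 0 : ℝ))
    (fun i => G.neighborFinset (i : V))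
  have hdet : (reducedLaplacian G w x).det = _ := (congrArg Matrix.det hrow).trans hmulti
  rw [hdet, Finset.sum_filter]
  refine Finset.sum_congr rfl fun r _ => ?_
  rw [MultilinearMap.map_smul_univ]
  have : (Matrix.detRowAlternating (n := {v // v ≠ x}) (R := ℝ)).toMultilinearMap
      (fun i k => ((if i = k then 1 else 0) - if r i = k then 1 else 0 : ℝ)) =
      (parentMatrix r).det := rfl
  rw [this, smul_eq_mul]
  split_ifs with h
  · rw [det_parentMatrix_of_leadsToRoot h, mul_one]
  · rw [det_parentMatrix_of_not_leadsToRoot h, mul_zero]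

theorem LeadsToRoot.edge_injective {x : V} {r : {v // v ≠ x} → V} (h : LeadsToRoot r) :
    Function.Injective fun i : {v // v ≠ x} => s((i : V), r i) := by
  obtain ⟨d, hd⟩ := h
  intro i j hij
  rcases Sym2.eq_iff.1 hij with ⟨h1, -⟩ | ⟨h1, h2⟩
  · exact Subtype.ext h1
  · have hi := hd i
    have hj := hd j
    rw [h2] at hi
    rw [← h1] at hj
    omega

/-- Edge set of a parent function. -/
def parentEdges {x : V} (r : {v // v ≠ x} → V) : Finset (Sym2 V) :=
  Finset.univ.image fun i : {v // v ≠ x} => s((i : V), r i)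

theorem LeadsToRoot.card_parentEdges {x : V} {r : {v // v ≠ x} → V} (h : LeadsToRoot r) :
    (parentEdges r).card + 1 = Fintype.card V := by
  rw [parentEdges, Finset.card_image_of_injective _ h.edge_injective, Finset.card_univ,
    Fintype.card_subtype_compl, Fintype.card_subtype_eq]
  exact Nat.sub_add_cancel (Fintype.card_pos_iff.2 ⟨x⟩)

theorem card_edgeSet_fromEdgeSet {G : SimpleGraph V} [DecidableRel G.Adj] {F : Finset (Sym2 V)}
    (hF : F ⊆ G.edgeFinset) :
    Nat.card (SimpleGraph.fromEdgeSet (F : Set (Sym2 V))).edgeSet = F.card := by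
  rw [SimpleGraph.edgeSet_fromEdgeSet, sdiff_eq_left.2, Nat.card_eq_card_toFinset]
  · simp
  · refine Set.disjoint_left.2 fun e he hd => ?_
    exact G.not_isDiag_of_mem_edgeFinset (hF he) hd

theorem LeadsToRoot.parentEdges_mem {G : SimpleGraph V} [DecidableRel G.Adj] {x : V}
    {r : {v // v ≠ x} → V} (h : LeadsToRoot r)
    (hr : r ∈ Fintype.piFinset (fun i : {v // v ≠ x} => G.neighborFinset (i : V))) :
    parentEdges r ∈ spanningTrees G := by
  have hadj : ∀ i : {v // v ≠ x}, G.Adj i (r i) := fun i => by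
    simpa using Fintype.mem_piFinset.1 hr i
  have hsub : parentEdges r ⊆ G.edgeFinset := by
    intro e he
    obtain ⟨i, -, rfl⟩ := Finset.mem_image.1 he
    simpa using hadj i
  rw [spanningTrees, Finset.mem_filter, Finset.mem_powerset]
  refine ⟨hsub, SimpleGraph.isTree_iff_connected_and_card.2 ⟨?_, ?_⟩⟩
  · have hreach : ∀ v, (SimpleGraph.fromEdgeSet (parentEdges r : Set (Sym2 V))).Reachable v x := by
      obtain ⟨d, hd⟩ := h
      intro v
      induction hn : d v using Nat.strong_induction_on generalizing v with
      | _ n ih =>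
        by_cases hv : v = x
        · rw [hv]
        · have hA : (SimpleGraph.fromEdgeSet (parentEdges r : Set (Sym2 V))).Adj v (r ⟨v, hv⟩) := by
            rw [SimpleGraph.fromEdgeSet_adj]
            exact ⟨Finset.mem_coe.2 (Finset.mem_image.2 ⟨⟨v, hv⟩, Finset.mem_univ _, rfl⟩),
              (hadj ⟨v, hv⟩).ne⟩
          exact hA.reachable.trans (ih _ (hn ▸ hd ⟨v, hv⟩) _ rfl)
    exact (SimpleGraph.connected_iff _).2
      ⟨fun u v => (hreach u).trans (hreach v).symm, ⟨x⟩⟩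
  · rw [card_edgeSet_fromEdgeSet hsub, h.card_parentEdges, Nat.card_eq_fintype_card]

theorem LeadsToRoot.eq_of_parentEdges_eq {x : V} {r r' : {v // v ≠ x} → V}
    (h' : LeadsToRoot r') (he : parentEdges r = parentEdges r') : r = r' := by
  obtain ⟨d, hd⟩ := h'
  by_contra hne
  obtain ⟨i, hi⟩ := Function.ne_iff.1 hne
  induction hn : d i using Nat.strong_induction_on generalizing i with
  | _ n ih =>
    have hmem : s((i : V), r' i) ∈ parentEdges r := by
      rw [he]
      exact Finset.mem_image.2 ⟨i, Finset.mem_univ _, rfl⟩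
    obtain ⟨j, -, hj⟩ := Finset.mem_image.1 hmem
    rcases Sym2.eq_iff.1 hj with ⟨h1, h2⟩ | ⟨h1, h2⟩
    · rw [Subtype.ext h1] at h2
      exact hi h2
    · have hdi := hd i
      rw [← h1] at hdi
      refine ih _ (hn ▸ hdi) j ?_ rfl
      intro h3
      have hdj := hd j
      rw [← h3, h2] at hdj
      omega

theorem exists_parent_of_mem_spanningTrees {G : SimpleGraph V} [DecidableRel G.Adj] (x : V)
    {F : Finset (Sym2 V)} (hF : F ∈ spanningTrees G) :
    ∃ r ∈ Fintype.piFinset (fun i : {v // v ≠ x} => G.neighborFinset (i : V)),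
      LeadsToRoot r ∧ parentEdges r = F := by
  rw [spanningTrees, Finset.mem_filter, Finset.mem_powerset] at hF
  obtain ⟨hsub, htree⟩ := hF
  set H := SimpleGraph.fromEdgeSet (F : Set (Sym2 V)) with hH
  have hex : ∀ i : {v // v ≠ x}, ∃ j, H.Adj i j ∧ H.dist j x < H.dist i x := by
    intro i
    obtain ⟨i, hi⟩ := i
    obtain ⟨p, hp⟩ := (htree.connected i x).exists_walk_length_eq_dist
    cases p with
    | nil => exact absurd rfl hi
    | cons hA q =>
      refine ⟨_, hA, ?_⟩
      rw [← hp, SimpleGraph.Walk.length_cons]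
      exact Nat.lt_succ_of_le (SimpleGraph.dist_le q)
  choose r hr1 hr2 using hex
  have hlead : LeadsToRoot r := ⟨fun v => H.dist v x, hr2⟩
  have hmem : ∀ i : {v // v ≠ x}, s((i : V), r i) ∈ F := fun i =>
    ((SimpleGraph.fromEdgeSet_adj _).1 (hr1 i)).1
  refine ⟨r, Fintype.mem_piFinset.2 fun i => ?_, hlead, ?_⟩
  · rw [SimpleGraph.mem_neighborFinset]
    simpa using hsub (hmem i)
  · refine Finset.eq_of_subset_of_card_le ?_ ?_
    · intro e he
      obtain ⟨i, -, rfl⟩ := Finset.mem_image.1 he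
      exact hmem i
    · have h1 := (SimpleGraph.isTree_iff_connected_and_card.1 htree).2
      rw [card_edgeSet_fromEdgeSet hsub, Nat.card_eq_fintype_card] at h1
      have h2 := hlead.card_parentEdges
      omega

/-- The weighted matrix-tree theorem. -/
theorem tau_eq_det_reducedLaplacian (G : SimpleGraph V) [DecidableRel G.Adj] (w : Sym2 V → ℝ)
    (x : V) : tau G w = (reducedLaplacian G w x).det := by
  rw [det_reducedLaplacian_eq_sum, tau]
  symm
  refine Finset.sum_bij (fun r _ => parentEdges r) (fun r hr => ?_) (fun r hr r' hr' h => ?_)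
    (fun F hF => ?_) (fun r hr => ?_)
  · obtain ⟨h1, h2⟩ := Finset.mem_filter.1 hr
    exact h2.parentEdges_mem h1
  · exact (Finset.mem_filter.1 hr').2.eq_of_parentEdges_eq h
  · obtain ⟨r, h1, h2, h3⟩ := exists_parent_of_mem_spanningTrees x hF
    exact ⟨r, Finset.mem_filter.2 ⟨h1, h2⟩, h3⟩
  · rw [parentEdges, Finset.prod_image fun i _ j _ h =>
      (Finset.mem_filter.1 hr).2.edge_injective h]


/-! ### Product integrals and sums over edges -/

theorem lintegral_pi_prod_fin : ∀ (n : ℕ) (f : Fin n → ℝ → ℝ≥0∞), (∀ i, Measurable (f i)) →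
    ∫⁻ x : Fin n → ℝ, ∏ i, f i (x i) = ∏ i, ∫⁻ t, f i t
  | 0, f, _ => by
    simp [lintegral_unique, volume_pi]
  | n + 1, f, hf => by
    have hm : Measurable fun x : Fin n → ℝ => ∏ i, f i.succ (x i) :=
      Finset.measurable_fun_prod _ fun i _ => (hf _).comp (measurable_pi_apply i)
    have hm' : Measurable fun x : Fin (n + 1) → ℝ => ∏ i, f i (x i) :=
      Finset.measurable_fun_prod _ fun i _ => (hf _).comp (measurable_pi_apply i)
    rw [← (volume_preserving_piFinSuccAbove (fun _ : Fin (n + 1) => ℝ) 0).symm.lintegral_comp hm',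
      Fin.prod_univ_succ, ← lintegral_pi_prod_fin n _ fun i => hf i.succ,
      ← lintegral_prod_mul (hf 0).aemeasurable hm.aemeasurable, Measure.volume_eq_prod]
    refine lintegral_congr fun p => ?_
    simp [Fin.prod_univ_succ, MeasurableEquiv.piFinSuccAbove, Fin.insertNthEquiv]

theorem lintegral_pi_prod {ι : Type*} [Fintype ι] (f : ι → ℝ → ℝ≥0∞) (hf : ∀ i, Measurable (f i)) :
    ∫⁻ x : ι → ℝ, ∏ i, f i (x i) = ∏ i, ∫⁻ t, f i t := by
  set e : Fin (Fintype.card ι) ≃ ι := (Fintype.equivFin ι).symm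
  rw [← (volume_measurePreserving_piCongrLeft (fun _ : ι => ℝ) e).lintegral_comp_emb
    (MeasurableEquiv.measurableEmbedding _), ← Equiv.prod_comp e,
    ← lintegral_pi_prod_fin _ _ fun i => hf (e i)]
  refine lintegral_congr fun x => ?_
  rw [← Equiv.prod_comp e]
  simp [MeasurableEquiv.coe_piCongrLeft, Equiv.piCongrLeft_apply_apply]

variable (G : SimpleGraph V) [DecidableRel G.Adj]

/-- Summation by parts over the edges of a graph. -/
theorem sum_mul_vw (f : Sym2 V → ℝ) (g : V → ℝ) :
    ∑ v, g v * vw G f v = ∑ e ∈ G.edgeFinset, f e * ssum g e := by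
  have h1 : ∑ v, g v * vw G f v = ∑ d : G.Dart, g d.fst * f d.edge := by
    rw [← Finset.sum_fiberwise_of_maps_to (s := Finset.univ) (t := Finset.univ)
      (g := fun d : G.Dart => d.fst) (fun _ _ => Finset.mem_univ _)]
    refine Finset.sum_congr rfl fun v _ => ?_
    rw [vw, Finset.mul_sum]
    refine Finset.sum_bij' (fun j hj => ⟨(v, j), (by simpa using hj)⟩) (fun d _ => d.snd)
      ?_ ?_ ?_ ?_ ?_
    · intro j hj; simp
    · rintro ⟨⟨a, b⟩, h⟩ hd
      simp only [Finset.mem_filter] at hd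
      obtain ⟨_, rfl⟩ := hd
      simpa using h
    · intros; rfl
    · rintro ⟨⟨a, b⟩, h⟩ hd
      simp only [Finset.mem_filter] at hd
      obtain ⟨_, rfl⟩ := hd
      rfl
    · intros; rfl
  rw [h1, ← Finset.sum_fiberwise_of_maps_to (s := Finset.univ) (t := G.edgeFinset)
    (g := fun d : G.Dart => d.edge) (fun d _ => by simp [d.edge_mem])]
  refine Finset.sum_congr rfl fun e he => ?_
  induction e using Sym2.ind with | _ a b =>
  have hab : G.Adj a b := by simpa using he
  have : (Finset.univ.filter fun d : G.Dart => d.edge = s(a, b)) =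
      {(⟨(a, b), hab⟩ : G.Dart), (⟨(a, b), hab⟩ : G.Dart).symm} := by
    convert (⟨(a, b), hab⟩ : G.Dart).edge_fiber
    rfl
  rw [this, Finset.sum_pair]
  · simp only [SimpleGraph.Dart.edge, SimpleGraph.Dart.symm, ssum, Sym2.lift_mk, Prod.swap,
      Sym2.eq_swap (a := b)]
    ring
  · exact (SimpleGraph.Dart.symm_ne _).symm

theorem sum_vw (f : Sym2 V → ℝ) : ∑ v, vw G f v = 2 * ∑ e ∈ G.edgeFinset, f e := by
  have := sum_mul_vw G f fun _ => 1
  simp only [one_mul] at this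
  rw [this, Finset.mul_sum]
  refine Finset.sum_congr rfl fun e _ => ?_
  induction e using Sym2.ind with | _ a b =>
  simp only [ssum, Sym2.lift_mk]
  ring

theorem sum_edgeFinset_eq {e0 : Sym2 V} (he0 : e0 ∈ G.edgeFinset) (f : Sym2 V → ℝ) :
    ∑ e ∈ G.edgeFinset, f e = f e0 + ∑ e : Epin G e0, f e := by
  rw [← Finset.add_sum_erase _ _ he0]
  congr 1
  exact Finset.sum_subtype _ (fun e => by simp [and_comm]) f

theorem prod_edgeFinset_eq {e0 : Sym2 V} (he0 : e0 ∈ G.edgeFinset) (f : Sym2 V → ℝ) :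
    ∏ e ∈ G.edgeFinset, f e = f e0 * ∏ e : Epin G e0, f e := by
  rw [← Finset.mul_prod_erase _ _ he0]
  congr 1
  exact Finset.prod_subtype _ (fun e => by simp [and_comm]) f

variable {G}

theorem vw_congr {f g : Sym2 V → ℝ} (h : ∀ e ∈ G.edgeFinset, f e = g e) (v : V) :
    vw G f v = vw G g v :=
  Finset.sum_congr rfl fun j hj => h _ (by simpa using hj)

theorem tau_congr {f g : Sym2 V → ℝ} (h : ∀ e ∈ G.edgeFinset, f e = g e) :
    tau G f = tau G g := by
  refine Finset.sum_congr rfl fun F hF => Finset.prod_congr rfl fun e he => h e ?_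
  simp only [spanningTrees, Finset.mem_filter, Finset.mem_powerset] at hF
  exact hF.1 he

theorem vw_smul (c : ℝ) (w : Sym2 V → ℝ) (v : V) : vw G (fun e => c * w e) v = c * vw G w v := by
  simp [vw, Finset.mul_sum]

theorem card_of_mem_spanningTrees {F : Finset (Sym2 V)} (hF : F ∈ spanningTrees G) :
    F.card + 1 = Fintype.card V := by
  simp only [spanningTrees, Finset.mem_filter, Finset.mem_powerset] at hF
  rw [← card_edgeSet_fromEdgeSet hF.1, Nat.card_eq_fintype_card, ← SimpleGraph.edgeFinset_card]
  convert hF.2.card_edgeFinset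

theorem tau_smul (c : ℝ) (w : Sym2 V → ℝ) :
    tau G (fun e => c * w e) = c ^ (Fintype.card V - 1) * tau G w := by
  rw [tau, tau, Finset.mul_sum]
  refine Finset.sum_congr rfl fun F hF => ?_
  rw [Finset.prod_mul_distrib, Finset.prod_const]
  congr 2
  have := card_of_mem_spanningTrees hF
  omega

theorem vw_pos (hG : G.Connected) {e0 : Sym2 V} (he0 : e0 ∈ G.edgeFinset) {w : Sym2 V → ℝ}
    (hw : ∀ e ∈ G.edgeFinset, 0 < w e) (v : V) : 0 < vw G w v := by
  have : Nontrivial V := by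
    induction e0 using Sym2.ind with | _ a b =>
    exact ⟨a, b, (show G.Adj a b by simpa using he0).ne⟩
  refine Finset.sum_pos (fun j hj => hw _ (by simpa using hj)) ?_
  rw [← Finset.card_pos, SimpleGraph.card_neighborFinset_eq_degree]
  exact hG.preconnected.degree_pos_of_nontrivial v

/-! ### The joint weight of edge and vertex fields -/

variable (G)

/-- Extension by zero of a field on the non-root vertices. -/
def rootExt (x : V) (u : {v : V // v ≠ x} → ℝ) : V → ℝ :=
  fun v => if h : v ≠ x then u ⟨v, h⟩ else 0

/-- Joint weight of a logarithmic environment `r` and a field `u` on the non-root vertices. -/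
def jointWeight (x : V) (a r : Sym2 V → ℝ) (u : {v : V // v ≠ x} → ℝ) : ℝ :=
  exp (∑ e ∈ G.edgeFinset, a e * r e - ∑ i : {v : V // v ≠ x}, (vw G a i + 1) * u i -
      1 / 2 * ∑ v, vw G (fun e => exp (r e)) v * exp (-2 * rootExt x u v)) *
    √(tau G fun e => exp (r e))

/-- Conductances between non-root vertices. -/
def innerW (x : V) (s : Sym2 V → ℝ) (i j : {v : V // v ≠ x}) : ℝ :=
  if G.Adj i j then exp (s s((i : V), (j : V))) else 0

/-- Conductances to the root. -/
def rootEta (x : V) (s : Sym2 V → ℝ) (i : {v : V // v ≠ x}) : ℝ :=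
  if G.Adj i x then exp (s s((i : V), x)) else 0

/-- The symmetric edge function `{i, j} ↦ cosh (U i - U j)`. -/
def scosh (U : V → ℝ) : Sym2 V → ℝ :=
  Sym2.lift ⟨fun i j => cosh (U i - U j), fun i j => by
    simp only [← cosh_neg (U i - U j), neg_sub]⟩

variable {G}

@[simp] theorem rootExt_self (x : V) (u : {v : V // v ≠ x} → ℝ) : rootExt x u x = 0 := by
  simp [rootExt]

@[simp] theorem rootExt_coe {x : V} (u : {v : V // v ≠ x} → ℝ) (i : {v : V // v ≠ x}) :
    rootExt x u i = u i := by
  simp [rootExt, i.2]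

theorem vw_eq_sum_ite (f : Sym2 V → ℝ) (v : V) :
    vw G f v = ∑ j, if G.Adj v j then f s(v, j) else 0 := by
  rw [vw, ← Finset.sum_filter]
  congr 1
  ext j
  simp

theorem vw_eq_sum_inner (x : V) (f : Sym2 V → ℝ) (v : V) :
    vw G f v = (if G.Adj v x then f s(v, x) else 0) +
      ∑ j : {v : V // v ≠ x}, if G.Adj v j then f s(v, (j : V)) else 0 := by
  rw [vw_eq_sum_ite, Fintype.sum_eq_add_sum_subtype_ne _ x]

theorem sum_edge_eq_inner (x : V) (f : Sym2 V → ℝ) :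
    ∑ e ∈ G.edgeFinset, f e =
      1 / 2 * (∑ i : {v : V // v ≠ x}, ∑ j : {v : V // v ≠ x},
        if G.Adj i j then f s((i : V), (j : V)) else 0) +
      ∑ i : {v : V // v ≠ x}, if G.Adj i x then f s((i : V), x) else 0 := by
  have h := sum_vw G f
  rw [Fintype.sum_eq_add_sum_subtype_ne _ x] at h
  simp only [vw_eq_sum_inner x f, Finset.sum_add_distrib] at h
  have h' : ∑ j : {v : V // v ≠ x}, (if G.Adj x j then f s(x, (j : V)) else 0) =
      ∑ i : {v : V // v ≠ x}, if G.Adj i x then f s((i : V), x) else 0 := by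
    refine Finset.sum_congr rfl fun i _ => ?_
    simp only [G.adj_comm x, Sym2.eq_swap (a := x)]
  rw [h'] at h
  simp only [SimpleGraph.irrefl, if_false, zero_add] at h
  linarith

theorem sum_exp_add_vrjpEnergy (x : V) (s : Sym2 V → ℝ) (u : {v : V // v ≠ x} → ℝ) :
    ∑ e ∈ G.edgeFinset, exp (s e) + vrjpEnergy (innerW G x s) (rootEta G x s) u =
      ∑ e ∈ G.edgeFinset, exp (s e) * scosh (rootExt x u) e := by
  have h : vrjpEnergy (innerW G x s) (rootEta G x s) u =
      ∑ e ∈ G.edgeFinset, exp (s e) * (scosh (rootExt x u) e - 1) := by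
    rw [sum_edge_eq_inner x, vrjpEnergy]
    simp [innerW, rootEta, scosh, ite_mul]
  rw [h, ← Finset.sum_add_distrib]
  exact Finset.sum_congr rfl fun e _ => by ring

theorem half_sum_vw_exp (s : Sym2 V → ℝ) (U : V → ℝ) :
    1 / 2 * ∑ v, vw G (fun e => exp (s e + ssum U e)) v * exp (-2 * U v) =
      ∑ e ∈ G.edgeFinset, exp (s e) * scosh U e := by
  have h := sum_mul_vw G (fun e => exp (s e + ssum U e)) fun v => exp (-2 * U v)
  simp only [mul_comm (exp (-2 * _))] at h
  rw [h, Finset.mul_sum]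
  refine Finset.sum_congr rfl fun e _ => ?_
  induction e using Sym2.ind with | _ i j =>
  simp only [ssum, scosh, Sym2.lift_mk, cosh_eq, exp_add, mul_assoc]
  rw [mul_left_comm]
  congr 1
  rw [show U i - U j = -2 * U j + (U i + U j) by ring,
    show -(-2 * U j + (U i + U j)) = -2 * U i + (U i + U j) by ring]
  simp only [exp_add]
  ring

theorem det_reducedLaplacian_exp (x : V) (s : Sym2 V → ℝ) (u : {v : V // v ≠ x} → ℝ) :
    (reducedLaplacian G (fun e => exp (s e + ssum (rootExt x u) e)) x).det =
      exp (∑ i, u i) ^ 2 * (vrjpMatrix (innerW G x s) (rootEta G x s) u).det := by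
  have h : reducedLaplacian G (fun e => exp (s e + ssum (rootExt x u) e)) x =
      Matrix.of fun i j => exp (u i) *
        (Matrix.of fun i j => exp (u j) * vrjpMatrix (innerW G x s) (rootEta G x s) u i j) i j := by
    ext i j
    have hoff : (if G.Adj i j then exp (s s((i : V), (j : V)) + ssum (rootExt x u) s((i : V), (j : V)))
        else 0) = exp (u i) * (exp (u j) * innerW G x s i j) := by
      simp only [innerW, ssum, Sym2.lift_mk, rootExt_coe, exp_add]
      split_ifs <;> ring
    simp only [reducedLaplacian, vrjpMatrix, Matrix.of_apply, hoff, mul_sub]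
    congr 1
    by_cases hij : i = j
    · subst hij
      rw [if_pos rfl, if_pos rfl, vw_eq_sum_inner x, mul_div_cancel₀ _ (exp_pos _).ne', mul_add,
        add_comm, Finset.mul_sum]
      congr 1
      · refine Finset.sum_congr rfl fun k _ => ?_
        simp only [innerW, ssum, Sym2.lift_mk, rootExt_coe, exp_add]
        split_ifs <;> ring
      · simp only [rootEta, ssum, Sym2.lift_mk, rootExt_coe, rootExt_self, exp_add, exp_zero]
        split_ifs <;> ring
    · simp [hij]
  rw [h, Matrix.det_mul_column, Matrix.det_mul_row, ← exp_sum]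
  rw [sq, mul_assoc]

theorem jointWeight_shift (x : V) (a s : Sym2 V → ℝ) (u : {v : V // v ≠ x} → ℝ) :
    jointWeight G x a (fun e => s e + ssum (rootExt x u) e) u =
      exp (∑ e ∈ G.edgeFinset, (a e * s e - exp (s e))) *
        (exp (-vrjpEnergy (innerW G x s) (rootEta G x s) u) *
          √(vrjpMatrix (innerW G x s) (rootEta G x s) u).det) := by
  rw [jointWeight, half_sum_vw_exp, ← sum_exp_add_vrjpEnergy, tau_eq_det_reducedLaplacian _ _ x,
    det_reducedLaplacian_exp, sqrt_mul (sq_nonneg _), sqrt_sq (exp_pos _).le, ← mul_assoc,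
    ← mul_assoc, ← exp_add, ← exp_add]
  congr 2
  simp only [mul_add, add_mul, one_mul, Finset.sum_add_distrib, Finset.sum_sub_distrib]
  have h := sum_mul_vw G a (rootExt x u)
  rw [← h, Fintype.sum_eq_add_sum_subtype_ne _ x]
  simp only [rootExt_self, rootExt_coe, mul_comm]
  ring

theorem escapes_inner (hG : G.Connected) (x : V) (s : Sym2 V → ℝ) :
    Escapes (innerW G x s) (rootEta G x s) := by
  rintro S ⟨i, hi⟩
  obtain ⟨p⟩ := hG.preconnected (i : V) x
  obtain ⟨d, _, hd1, hd2⟩ := p.exists_boundary_dart ((↑) '' S : Set V) ⟨i, hi, rfl⟩ (by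
    rintro ⟨j, _, hj⟩
    exact j.2 hj)
  obtain ⟨k, hk, hkd⟩ := hd1
  have hadj : G.Adj k d.snd := hkd ▸ d.adj
  refine ⟨k, hk, ?_⟩
  by_cases hx : d.snd = x
  · left
    rw [rootEta, if_pos (hx ▸ hadj)]
    exact exp_pos _
  · right
    refine ⟨⟨d.snd, hx⟩, fun hm => hd2 ⟨_, hm, rfl⟩, ?_⟩
    rw [innerW, if_pos hadj]
    exact exp_pos _

theorem lintegral_jointWeight_shift (hG : G.Connected) (x : V) (a s : Sym2 V → ℝ) :
    ∫⁻ u : {v : V // v ≠ x} → ℝ,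
        ENNReal.ofReal (jointWeight G x a (fun e => s e + ssum (rootExt x u) e) u) =
      ENNReal.ofReal (exp (∑ e ∈ G.edgeFinset, (a e * s e - exp (s e)))) *
        ENNReal.ofReal √(2 * π) ^ (Fintype.card V - 1) := by
  simp only [jointWeight_shift, ENNReal.ofReal_mul (exp_pos _).le]
  rw [lintegral_const_mul' _ _ ENNReal.ofReal_ne_top]
  simp only [← ENNReal.ofReal_mul (exp_pos _).le]
  have hc : Fintype.card {v : V // v ≠ x} = Fintype.card V - 1 := by simp
  rw [← hc, ← lintegral_vrjp (innerW G x s) (rootEta G x s)]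
  · congr!
  · intro i j
    simp only [innerW, G.adj_comm i j, Sym2.eq_swap (a := (i : V))]
  · intro i j
    unfold innerW
    split_ifs <;> positivity
  · intro i
    unfold rootEta
    split_ifs <;> positivity
  · exact escapes_inner hG x s

/-! ### Normalization of the magic formula -/

variable (G)

/-- Logarithmic environment with value `p.1` at the reference edge. -/
def logW (e0 : Sym2 V) (p : ℝ × (Epin G e0 → ℝ)) : Sym2 V → ℝ :=
  fun e => if e = e0 then p.1 else if h : e ∈ G.edgeFinset ∧ e ≠ e0 then p.2 ⟨e, h⟩ else 0

variable {G}

theorem logW_ref (e0 : Sym2 V) (p : ℝ × (Epin G e0 → ℝ)) :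
    logW G e0 p e0 = p.1 := by
  simp [logW]

theorem logW_coe {e0 : Sym2 V} (p : ℝ × (Epin G e0 → ℝ)) (e : Epin G e0) :
    logW G e0 p e = p.2 e := by
  have := e.2
  simp only [logW]
  rw [if_neg this.2, dif_pos this]

theorem logW_add {e0 : Sym2 V} (p : ℝ × (Epin G e0 → ℝ)) (g : Sym2 V → ℝ) {e : Sym2 V}
    (he : e ∈ G.edgeFinset) :
    logW G e0 (p + (g e0, fun e : Epin G e0 => g e)) e = logW G e0 p e + g e := by
  by_cases h : e = e0
  · subst h
    simp [logW_ref]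
  · have h1 := logW_coe (p + (g e0, fun e : Epin G e0 => g e)) ⟨e, he, h⟩
    have h2 := logW_coe p ⟨e, he, h⟩
    simp only at h1 h2
    rw [h1, h2]
    rfl

theorem continuous_logW (e0 e : Sym2 V) : Continuous fun p => logW G e0 p e := by
  unfold logW
  split_ifs <;> fun_prop

theorem continuous_rootExt (x v : V) : Continuous fun u => rootExt x u v := by
  unfold rootExt
  split_ifs <;> fun_prop

theorem continuous_jointWeight (x : V) (e0 : Sym2 V) (a : Sym2 V → ℝ) :
    Continuous fun q : ({v : V // v ≠ x} → ℝ) × (ℝ × (Epin G e0 → ℝ)) =>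
      jointWeight G x a (logW G e0 q.2) q.1 := by
  have h1 : ∀ e, Continuous fun q : ({v : V // v ≠ x} → ℝ) × (ℝ × (Epin G e0 → ℝ)) =>
      logW G e0 q.2 e := fun e => (continuous_logW e0 e).comp continuous_snd
  have h2 : ∀ v, Continuous fun q : ({v : V // v ≠ x} → ℝ) × (ℝ × (Epin G e0 → ℝ)) =>
      rootExt x q.1 v := fun v => (continuous_rootExt x v).comp continuous_fst
  unfold jointWeight vw tau
  fun_prop

theorem jointWeight_congr {x : V} {a r r' : Sym2 V → ℝ} (h : ∀ e ∈ G.edgeFinset, r e = r' e)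
    (u : {v : V // v ≠ x} → ℝ) : jointWeight G x a r u = jointWeight G x a r' u := by
  have h' : ∀ e ∈ G.edgeFinset, exp (r e) = exp (r' e) := fun e he => by rw [h e he]
  rw [jointWeight, jointWeight, tau_congr h', Finset.sum_congr rfl fun e he => by rw [h e he]]
  simp only [vw_congr h']

theorem lintegral_gamma_edges {e0 : Sym2 V} (he0 : e0 ∈ G.edgeFinset) {a : Sym2 V → ℝ}
    (ha : ∀ e ∈ G.edgeFinset, 0 < a e) :
    ∫⁻ p : ℝ × (Epin G e0 → ℝ), ENNReal.ofReal
        (exp (∑ e ∈ G.edgeFinset, (a e * logW G e0 p e - exp (logW G e0 p e)))) =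
      ENNReal.ofReal (∏ e ∈ G.edgeFinset, Gamma (a e)) := by
  have h1 : ∀ b : ℝ, 0 < b → ∫⁻ t : ℝ, ENNReal.ofReal (exp (b * t - exp t)) =
      ENNReal.ofReal (Gamma b) := fun b hb => by
    simpa using lintegral_exp_gamma one_ne_zero hb one_pos
  have hm : ∀ b : ℝ, Measurable fun t : ℝ => ENNReal.ofReal (exp (b * t - exp t)) := fun b => by
    fun_prop
  have hpos : ∀ e : Epin G e0, 0 < a e := fun e => ha e e.2.1
  rw [prod_edgeFinset_eq G he0, ENNReal.ofReal_mul (Gamma_pos_of_pos (ha _ he0)).le,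
    ENNReal.ofReal_prod_of_nonneg fun e _ => (Gamma_pos_of_pos (hpos e)).le, ← h1 _ (ha _ he0),
    Finset.prod_congr rfl fun e _ => (h1 _ (hpos e)).symm,
    ← lintegral_pi_prod (fun (e : Epin G e0) t => ENNReal.ofReal (exp (a e * t - exp t)))
      fun e => hm _, ← lintegral_prod_mul (hm _).aemeasurable (by fun_prop),
    Measure.volume_eq_prod]
  refine lintegral_congr fun p => ?_
  rw [sum_edgeFinset_eq G he0, exp_add, ENNReal.ofReal_mul (exp_pos _).le, exp_sum,
    ENNReal.ofReal_prod_of_nonneg fun e _ => (exp_pos _).le]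
  simp only [logW_ref, logW_coe]

theorem lintegral_lintegral_jointWeight (hG : G.Connected) (x : V) {e0 : Sym2 V}
    (he0 : e0 ∈ G.edgeFinset) {a : Sym2 V → ℝ} (ha : ∀ e ∈ G.edgeFinset, 0 < a e) :
    ∫⁻ p : ℝ × (Epin G e0 → ℝ), ∫⁻ u : {v : V // v ≠ x} → ℝ,
        ENNReal.ofReal (jointWeight G x a (logW G e0 p) u) =
      ENNReal.ofReal (∏ e ∈ G.edgeFinset, Gamma (a e)) *
        ENNReal.ofReal √(2 * π) ^ (Fintype.card V - 1) := by
  set Q : ({v : V // v ≠ x} → ℝ) → ℝ × (Epin G e0 → ℝ) := fun u =>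
    (ssum (rootExt x u) e0, fun e => ssum (rootExt x u) e) with hQ
  have hss : ∀ e, Continuous fun u : {v : V // v ≠ x} → ℝ => ssum (rootExt x u) e := fun e => by
    induction e using Sym2.ind with | _ i j =>
    simp only [ssum, Sym2.lift_mk]
    exact (continuous_rootExt x i).add (continuous_rootExt x j)
  have hQc : Continuous Q := (hss e0).prodMk (continuous_pi fun e => hss e)
  have hF := (continuous_jointWeight (G := G) x e0 a).measurable.ennreal_ofReal
  have hshift : ∀ (u : {v : V // v ≠ x} → ℝ) (p : ℝ × (Epin G e0 → ℝ)),
      jointWeight G x a (logW G e0 (p + Q u)) u =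
        jointWeight G x a (fun e => logW G e0 p e + ssum (rootExt x u) e) u := fun u p =>
    jointWeight_congr (fun e he => logW_add p (ssum (rootExt x u)) he) u
  rw [← lintegral_lintegral_swap (f := fun u p =>
    ENNReal.ofReal (jointWeight G x a (logW G e0 p) u)) hF.aemeasurable]
  have : (volume : Measure (ℝ × (Epin G e0 → ℝ))).IsAddRightInvariant := by
    rw [Measure.volume_eq_prod]
    infer_instance
  have h1 : ∀ u : {v : V // v ≠ x} → ℝ, ∫⁻ p : ℝ × (Epin G e0 → ℝ),
      ENNReal.ofReal (jointWeight G x a (logW G e0 p) u) = ∫⁻ p : ℝ × (Epin G e0 → ℝ),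
        ENNReal.ofReal (jointWeight G x a (logW G e0 (p + Q u)) u) := fun u =>
    (lintegral_add_right_eq_self (fun p =>
      ENNReal.ofReal (jointWeight G x a (logW G e0 p) u)) (Q u)).symm
  have hc : Continuous fun q : ({v : V // v ≠ x} → ℝ) × (ℝ × (Epin G e0 → ℝ)) =>
      (q.1, q.2 + Q q.1) := by fun_prop
  rw [lintegral_congr h1, lintegral_lintegral_swap (f := fun u p =>
    ENNReal.ofReal (jointWeight G x a (logW G e0 (p + Q u)) u))
    (hF.comp hc.measurable).aemeasurable]
  simp only [hshift, lintegral_jointWeight_shift hG]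
  rw [lintegral_mul_const' _ _ (ENNReal.pow_ne_top ENNReal.ofReal_ne_top),
    lintegral_gamma_edges he0 ha]

variable (G) in
/-- Unnormalized magic density in logarithmic coordinates. -/
def logKernel (x : V) (a r : Sym2 V → ℝ) : ℝ :=
  exp (∑ e ∈ G.edgeFinset, a e * r e) * √(tau G fun e => exp (r e)) *
    ∏ v, vw G (fun e => exp (r e)) v ^ (-bwt G x a v)

theorem bwt_self (x : V) (a : Sym2 V → ℝ) : bwt G x a x = vw G a x / 2 := by
  simp [bwt]

theorem bwt_coe (x : V) (a : Sym2 V → ℝ) (i : {v : V // v ≠ x}) :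
    bwt G x a i = (vw G a i + 1) / 2 := by
  simp [bwt, i.2]

theorem bwt_pos (hG : G.Connected) {e0 : Sym2 V} (he0 : e0 ∈ G.edgeFinset) {a : Sym2 V → ℝ}
    (ha : ∀ e ∈ G.edgeFinset, 0 < a e) (x v : V) : 0 < bwt G x a v := by
  have := vw_pos hG he0 ha v
  unfold bwt
  split_ifs <;> linarith

theorem card_ne_eq (x : V) : (Fintype.card {v : V // v ≠ x} : ℝ) = Fintype.card V - 1 := by
  have h := Fintype.sum_eq_add_sum_subtype_ne (fun _ : V => (1 : ℝ)) x
  simp only [Finset.sum_const, Finset.card_univ, nsmul_eq_mul, mul_one] at h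
  linarith

theorem sum_bwt (x : V) (a : Sym2 V → ℝ) :
    ∑ v, bwt G x a v = ∑ e ∈ G.edgeFinset, a e + ((Fintype.card V : ℝ) - 1) / 2 := by
  simp only [bwt, ← Finset.sum_div, Finset.sum_sub_distrib, Finset.sum_add_distrib, sum_vw,
    Finset.sum_const, Finset.card_univ, nsmul_eq_mul, mul_one, Finset.sum_ite_eq',
    Finset.mem_univ, if_true]
  ring

theorem lintegral_jointWeight (hG : G.Connected) (x : V) {e0 : Sym2 V}
    (he0 : e0 ∈ G.edgeFinset) {a : Sym2 V → ℝ} (ha : ∀ e ∈ G.edgeFinset, 0 < a e)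
    (r : Sym2 V → ℝ) :
    ∫⁻ u : {v : V // v ≠ x} → ℝ, ENNReal.ofReal (jointWeight G x a r u) =
      ENNReal.ofReal (exp (∑ e ∈ G.edgeFinset, a e * r e -
          1 / 2 * vw G (fun e => exp (r e)) x) * √(tau G fun e => exp (r e)) *
        ∏ i : {v : V // v ≠ x}, (1 / 2 * (Gamma (bwt G x a i) *
          (vw G (fun e => exp (r e)) i / 2) ^ (-bwt G x a i)))) := by
  set w : Sym2 V → ℝ := fun e => exp (r e)
  have hw : ∀ v, 0 < vw G w v := vw_pos hG he0 fun e _ => exp_pos _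
  have hpt : ∀ u : {v : V // v ≠ x} → ℝ, jointWeight G x a r u =
      exp (∑ e ∈ G.edgeFinset, a e * r e - 1 / 2 * vw G w x) * √(tau G w) *
        ∏ i : {v : V // v ≠ x}, exp (-2 * bwt G x a i * u i - vw G w i / 2 * exp (-2 * u i)) := by
    intro u
    rw [jointWeight, mul_right_comm, ← exp_sum, ← exp_add]
    congr 2
    rw [Fintype.sum_eq_add_sum_subtype_ne _ x, Finset.sum_sub_distrib, mul_add, Finset.mul_sum]
    simp only [rootExt_self, rootExt_coe, mul_zero, exp_zero, mul_one, bwt_coe]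
    have h1 : ∑ i : {v : V // v ≠ x}, (vw G a i + 1) * u i =
        -∑ i : {v : V // v ≠ x}, -2 * ((vw G a i + 1) / 2) * u i := by
      rw [← Finset.sum_neg_distrib]
      exact Finset.sum_congr rfl fun i _ => by ring
    have h2 : ∑ i : {v : V // v ≠ x}, 1 / 2 * (vw G w i * exp (-2 * u i)) =
        ∑ i : {v : V // v ≠ x}, vw G w i / 2 * exp (-2 * u i) :=
      Finset.sum_congr rfl fun i _ => by ring
    rw [h1, h2]
    ring
  have hC : 0 ≤ exp (∑ e ∈ G.edgeFinset, a e * r e - 1 / 2 * vw G w x) * √(tau G w) := by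
    positivity
  simp only [hpt, ENNReal.ofReal_mul hC]
  rw [lintegral_const_mul' _ _ ENNReal.ofReal_ne_top]
  congr 1
  rw [ENNReal.ofReal_prod_of_nonneg fun i _ => by
    have := Gamma_pos_of_pos (bwt_pos hG he0 ha x i)
    have := hw i
    positivity]
  simp only [ENNReal.ofReal_prod_of_nonneg fun i _ => (exp_pos _).le]
  rw [lintegral_pi_prod (fun (i : {v : V // v ≠ x}) t =>
    ENNReal.ofReal (exp (-2 * bwt G x a i * t - vw G w i / 2 * exp (-2 * t)))) fun i => by fun_prop]
  refine Finset.prod_congr rfl fun i _ => ?_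
  rw [lintegral_exp_gamma (by norm_num) (bwt_pos hG he0 ha x i) (by have := hw i; positivity)]
  norm_num

theorem lintegral_lintegral_jointWeight_eq (hG : G.Connected) (x : V) {e0 : Sym2 V}
    (he0 : e0 ∈ G.edgeFinset) {a : Sym2 V → ℝ} (ha : ∀ e ∈ G.edgeFinset, 0 < a e) :
    ∫⁻ p : ℝ × (Epin G e0 → ℝ), ∫⁻ u : {v : V // v ≠ x} → ℝ,
        ENNReal.ofReal (jointWeight G x a (logW G e0 p) u) =
      ENNReal.ofReal ((1 / 2) ^ (Fintype.card V - 1) *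
          ∏ v, (Gamma (bwt G x a v) * 2 ^ bwt G x a v)) *
        ∫⁻ r : Epin G e0 → ℝ, ENNReal.ofReal (logKernel G x a (logW G e0 (0, r))) := by
  have hb := bwt_pos hG he0 ha x
  set F : ℝ × (Epin G e0 → ℝ) → ℝ≥0∞ := fun p => ∫⁻ u : {v : V // v ≠ x} → ℝ,
    ENNReal.ofReal (jointWeight G x a (logW G e0 p) u) with hF
  have hFm : Measurable F :=
    Measurable.lintegral_prod_left' (f := fun q : ({v : V // v ≠ x} → ℝ) × (ℝ × (Epin G e0 → ℝ)) =>
      ENNReal.ofReal (jointWeight G x a (logW G e0 q.2) q.1))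
      (continuous_jointWeight x e0 a).measurable.ennreal_ofReal
  have hshift : ∀ (t : ℝ) (r : Epin G e0 → ℝ), F (t, r + fun _ => t) =
      ENNReal.ofReal (exp (∑ e ∈ G.edgeFinset, a e * logW G e0 (0, r) e) *
        √(tau G fun e => exp (logW G e0 (0, r) e)) *
        ∏ i : {v : V // v ≠ x}, (1 / 2 * (Gamma (bwt G x a i) *
          (vw G (fun e => exp (logW G e0 (0, r) e)) i / 2) ^ (-bwt G x a i)))) *
      ENNReal.ofReal (exp (1 * bwt G x a x * t -
        vw G (fun e => exp (logW G e0 (0, r) e)) x / 2 * exp (1 * t))) := by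
    intro t r
    set s := logW G e0 (0, r)
    have hlog : ∀ e ∈ G.edgeFinset, logW G e0 (t, r + fun _ => t) e = s e + t := by
      intro e he
      rw [← logW_add (0, r) (fun _ => t) he]
      simp
    have hexp : ∀ e ∈ G.edgeFinset, exp (logW G e0 (t, r + fun _ => t) e) = exp t * exp (s e) :=
      fun e he => by rw [hlog e he, exp_add, mul_comm]
    have hw : ∀ v, 0 < vw G (fun e => exp (s e)) v := vw_pos hG he0 fun e _ => exp_pos _
    simp only [hF]
    rw [lintegral_jointWeight hG x he0 ha, ← ENNReal.ofReal_mul (by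
      have h1 : ∀ i : {v : V // v ≠ x}, 0 ≤ 1 / 2 * (Gamma (bwt G x a i) *
          (vw G (fun e => exp (s e)) i / 2) ^ (-bwt G x a i)) := fun i => by
        have := Gamma_pos_of_pos (hb i)
        have := hw i
        positivity
      have := Finset.prod_nonneg fun i (_ : i ∈ Finset.univ) => h1 i
      positivity)]
    congr 1
    rw [tau_congr hexp, tau_smul, Finset.sum_congr rfl fun e he => by rw [hlog e he]]
    simp only [vw_congr hexp, vw_smul]
    rw [sqrt_mul (by positivity), sqrt_eq_rpow (exp t ^ _), ← exp_nat_mul, ← exp_mul]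
    have hprod : ∏ i : {v : V // v ≠ x}, (1 / 2 * (Gamma (bwt G x a i) *
          (exp t * vw G (fun e => exp (s e)) i / 2) ^ (-bwt G x a i))) =
        (∏ i : {v : V // v ≠ x}, (1 / 2 * (Gamma (bwt G x a i) *
          (vw G (fun e => exp (s e)) i / 2) ^ (-bwt G x a i)))) *
        exp (-t * ∑ i : {v : V // v ≠ x}, bwt G x a i) := by
      rw [Finset.mul_sum, exp_sum, ← Finset.prod_mul_distrib]
      refine Finset.prod_congr rfl fun i _ => ?_
      rw [mul_div_assoc, mul_rpow (exp_pos _).le (by have := hw i; positivity), ← exp_mul]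
      rw [show t * -bwt G x a i = -t * bwt G x a i by ring]
      ring
    rw [hprod]
    have hsum := sum_bwt (G := G) x a
    rw [Fintype.sum_eq_add_sum_subtype_ne _ x] at hsum
    have hcard : ((Fintype.card V - 1 : ℕ) : ℝ) = (Fintype.card V : ℝ) - 1 := by
      rw [← card_ne_eq x]
      simp
    have hE : exp (∑ e ∈ G.edgeFinset, a e * (s e + t) -
          1 / 2 * (exp t * vw G (fun e => exp (s e)) x)) *
          exp (((Fintype.card V - 1 : ℕ) : ℝ) * t * (1 / 2)) *
          exp (-t * ∑ i : {v : V // v ≠ x}, bwt G x a i) =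
        exp (∑ e ∈ G.edgeFinset, a e * s e) *
          exp (1 * bwt G x a x * t - vw G (fun e => exp (s e)) x / 2 * exp (1 * t)) := by
      rw [← exp_add, ← exp_add, ← exp_add, hcard]
      congr 1
      simp only [mul_add, Finset.sum_add_distrib, ← Finset.sum_mul, one_mul]
      linear_combination (-t) * hsum
    linear_combination (√(tau G fun e => exp (s e)) *
      (∏ i : {v : V // v ≠ x}, (1 / 2 * (Gamma (bwt G x a i) *
          (vw G (fun e => exp (s e)) i / 2) ^ (-bwt G x a i))))) * hE
  have hFm' : Measurable fun q : ℝ × (Epin G e0 → ℝ) => F (q.1, q.2 + fun _ => q.1) :=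
    hFm.comp (by fun_prop)
  have h1 : ∫⁻ p, F p = ∫⁻ r : Epin G e0 → ℝ, ∫⁻ t : ℝ, F (t, r + fun _ => t) := by
    rw [Measure.volume_eq_prod, lintegral_prod _ hFm.aemeasurable,
      ← lintegral_lintegral_swap (f := fun t r => F (t, r + fun _ => t)) hFm'.aemeasurable]
    exact lintegral_congr fun t =>
      (lintegral_add_right_eq_self (fun r => F (t, r)) fun _ => t).symm
  rw [h1, ← lintegral_const_mul' _ _ ENNReal.ofReal_ne_top]
  refine lintegral_congr fun r => ?_
  simp only [hshift]
  set s := logW G e0 (0, r)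
  have hw : ∀ v, 0 < vw G (fun e => exp (s e)) v := vw_pos hG he0 fun e _ => exp_pos _
  have hΓ : ∀ v, 0 < Gamma (bwt G x a v) := fun v => Gamma_pos_of_pos (hb v)
  rw [lintegral_const_mul' _ _ ENNReal.ofReal_ne_top,
    lintegral_exp_gamma one_ne_zero (hb x) (by have := hw x; positivity),
    ← ENNReal.ofReal_mul (by
      have h1 : ∀ i : {v : V // v ≠ x}, 0 ≤ 1 / 2 * (Gamma (bwt G x a i) *
          (vw G (fun e => exp (s e)) i / 2) ^ (-bwt G x a i)) := fun i => by
        have := hΓ i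
        have := hw i
        positivity
      have := Finset.prod_nonneg fun i (_ : i ∈ Finset.univ) => h1 i
      positivity),
    ← ENNReal.ofReal_mul (by
      have := Finset.prod_pos fun v (_ : v ∈ Finset.univ) =>
        mul_pos (hΓ v) (rpow_pos_of_pos two_pos (bwt G x a v))
      positivity)]
  congr 1
  have hsplit : ∏ v, (Gamma (bwt G x a v) * (vw G (fun e => exp (s e)) v / 2) ^ (-bwt G x a v)) =
      (∏ v, (Gamma (bwt G x a v) * 2 ^ bwt G x a v)) *
        ∏ v, vw G (fun e => exp (s e)) v ^ (-bwt G x a v) := by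
    rw [← Finset.prod_mul_distrib]
    refine Finset.prod_congr rfl fun v _ => ?_
    rw [div_rpow (hw v).le two_pos.le, rpow_neg two_pos.le, div_inv_eq_mul]
    ring
  rw [logKernel, mul_assoc ((1 / 2) ^ _), mul_left_comm (∏ v, _), ← hsplit,
    Fintype.prod_eq_mul_prod_subtype_ne _ x, Finset.prod_mul_distrib]
  simp only [Finset.prod_const, Finset.card_univ, abs_one, inv_one, one_mul]
  rw [show Fintype.card {v : V // v ≠ x} = Fintype.card V - 1 by simp]
  ring

theorem Znorm_pos (hG : G.Connected) {e0 : Sym2 V} (he0 : e0 ∈ G.edgeFinset) {a : Sym2 V → ℝ}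
    (ha : ∀ e ∈ G.edgeFinset, 0 < a e) (x : V) : 0 < Znorm G x a := by
  have h1 : 0 < ∏ e ∈ G.edgeFinset, Gamma (a e) :=
    Finset.prod_pos fun e he => Gamma_pos_of_pos (ha e he)
  have h2 : 0 < ∏ v, Gamma (bwt G x a v) :=
    Finset.prod_pos fun v _ => Gamma_pos_of_pos (bwt_pos hG he0 ha x v)
  have := pi_pos
  unfold Znorm
  positivity

theorem lintegral_logKernel (hG : G.Connected) (x : V) {e0 : Sym2 V}
    (he0 : e0 ∈ G.edgeFinset) {a : Sym2 V → ℝ} (ha : ∀ e ∈ G.edgeFinset, 0 < a e) :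
    ∫⁻ r : Epin G e0 → ℝ, ENNReal.ofReal (logKernel G x a (logW G e0 (0, r))) =
      ENNReal.ofReal (Znorm G x a) := by
  have h := (lintegral_lintegral_jointWeight_eq hG x he0 ha).symm.trans
    (lintegral_lintegral_jointWeight hG x he0 ha)
  have hΓ : 0 < ∏ v, Gamma (bwt G x a v) :=
    Finset.prod_pos fun v _ => Gamma_pos_of_pos (bwt_pos hG he0 ha x v)
  have hprod : ∏ v, (Gamma (bwt G x a v) * 2 ^ bwt G x a v) =
      (∏ v, Gamma (bwt G x a v)) * 2 ^ (∑ v, bwt G x a v) := by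
    rw [Finset.prod_mul_distrib, rpow_sum_of_pos two_pos]
  have hK : 0 < (1 / 2 : ℝ) ^ (Fintype.card V - 1) *
      ∏ v, (Gamma (bwt G x a v) * 2 ^ bwt G x a v) := by
    rw [hprod]
    positivity
  refine (ENNReal.mul_right_inj (ENNReal.ofReal_pos.2 hK).ne' ENNReal.ofReal_ne_top).1 ?_
  rw [h, ← ENNReal.ofReal_mul hK.le, ← ENNReal.ofReal_pow (sqrt_nonneg _),
    ← ENNReal.ofReal_mul (Finset.prod_nonneg fun e he => (Gamma_pos_of_pos (ha e he)).le)]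
  congr 1
  have hcard : ((Fintype.card V - 1 : ℕ) : ℝ) = (Fintype.card V : ℝ) - 1 := by
    rw [← card_ne_eq x]
    simp
  rw [hprod, sum_bwt, Znorm, sqrt_eq_rpow, ← rpow_mul_natCast (by positivity), hcard,
    mul_rpow two_pos.le pi_pos.le, one_div, inv_pow, ← rpow_natCast 2, hcard]
  rw [rpow_add two_pos (1 - _), show (1 : ℝ) - Fintype.card V = -((Fintype.card V : ℝ) - 1) by ring,
    rpow_neg two_pos.le, rpow_add two_pos]
  rw [show ((Fintype.card V : ℝ) - 1) / 2 = 2⁻¹ * ((Fintype.card V : ℝ) - 1) by ring]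
  field_simp

theorem prod_rpow_sub_one {e0 : Sym2 V} (he0 : e0 ∈ G.edgeFinset) (a s : Sym2 V → ℝ)
    (hs : s e0 = 0) :
    (∏ e : Epin G e0, exp (s e)) * ∏ e ∈ G.edgeFinset, exp (s e) ^ (a e - 1) =
      exp (∑ e ∈ G.edgeFinset, a e * s e) := by
  rw [sum_edgeFinset_eq G he0, prod_edgeFinset_eq G he0, hs, exp_zero, one_rpow, one_mul,
    ← Finset.prod_mul_distrib, mul_zero, zero_add, exp_sum]
  refine Finset.prod_congr rfl fun e _ => ?_
  rw [← exp_mul, ← exp_add]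
  congr 1
  ring

theorem magicDensity_exp (hG : G.Connected) (x : V) {e0 : Sym2 V} (he0 : e0 ∈ G.edgeFinset)
    (a s : Sym2 V → ℝ) (hs : s e0 = 0) :
    (∏ e : Epin G e0, exp (s e)) * magicDensity G x a (fun e => exp (s e)) =
      (Znorm G x a)⁻¹ * logKernel G x a s := by
  have hw : ∀ v, 0 < vw G (fun e => exp (s e)) v := vw_pos hG he0 fun e _ => exp_pos _
  rw [logKernel, ← prod_rpow_sub_one he0 a s hs, magicDensity]
  have h : vw G (fun e => exp (s e)) x ^ ((1 : ℝ) / 2) /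
      ∏ v, vw G (fun e => exp (s e)) v ^ ((vw G a v + 1) / 2) =
      ∏ v, vw G (fun e => exp (s e)) v ^ (-bwt G x a v) := by
    rw [Fintype.prod_eq_mul_prod_subtype_ne _ x,
      Fintype.prod_eq_mul_prod_subtype_ne (fun v => _ ^ (-bwt G x a v)) x, ← div_div,
      ← rpow_sub (hw x), bwt_self, div_eq_mul_inv, ← Finset.prod_inv_distrib]
    congr 1
    · congr 1
      ring
    · refine Finset.prod_congr rfl fun i _ => ?_
      rw [bwt_coe, rpow_neg (hw i).le]
  rw [← h]
  ring

theorem magicDensity_congr {x : V} {a w w' : Sym2 V → ℝ} (h : ∀ e ∈ G.edgeFinset, w e = w' e) :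
    magicDensity G x a w = magicDensity G x a w' := by
  simp only [magicDensity, vw_congr h, tau_congr h]
  rw [Finset.prod_congr rfl fun e he => by rw [h e he]]

theorem pinExt_ref (e0 : Sym2 V) (u : Epin G e0 → ℝ) : pinExt G e0 u e0 = 1 := by
  simp [pinExt]

theorem pinExt_coe {e0 : Sym2 V} (u : Epin G e0 → ℝ) (e : Epin G e0) :
    pinExt G e0 u e = u e := by
  have := e.2
  simp only [pinExt]
  rw [if_neg this.2, dif_pos this]

theorem pinExt_exp {e0 : Sym2 V} (r : Epin G e0 → ℝ) {e : Sym2 V} (he : e ∈ G.edgeFinset) :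
    pinExt G e0 (fun e => exp (r e)) e = exp (logW G e0 (0, r) e) := by
  by_cases h : e = e0
  · rw [h, pinExt_ref, logW_ref, exp_zero]
  · rw [pinExt_coe _ (⟨e, he, h⟩ : Epin G e0), logW_coe _ (⟨e, he, h⟩ : Epin G e0)]

theorem pinExt_pos_iff {e0 : Sym2 V} (u : Epin G e0 → ℝ) :
    (∀ e ∈ G.edgeFinset, 0 < pinExt G e0 u e) ↔ ∀ e, 0 < u e := by
  constructor
  · intro h e
    simpa only [pinExt_coe] using h e e.2.1
  · intro h e he
    by_cases h' : e = e0
    · rw [h', pinExt_ref]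
      exact one_pos
    · rw [pinExt_coe _ (⟨e, he, h'⟩ : Epin G e0)]
      exact h _

variable (G) in
/-- Density of the mixing measure in the free coordinates. -/
def pinDensity (e0 : Sym2 V) (x : V) (a : Sym2 V → ℝ) (u : Epin G e0 → ℝ) : ℝ≥0∞ :=
  ENNReal.ofReal (if ∀ e ∈ G.edgeFinset, 0 < pinExt G e0 u e then
    magicDensity G x a (pinExt G e0 u) else 0)

theorem lintegral_exp_coord {ι : Type*} [Fintype ι] (g : (ι → ℝ) → ℝ≥0∞) :
    ∫⁻ u in {u : ι → ℝ | ∀ i, 0 < u i}, g u =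
      ∫⁻ r : ι → ℝ, ENNReal.ofReal (∏ i, exp (r i)) * g fun i => exp (r i) := by
  set f : (ι → ℝ) → ι → ℝ := fun r i => exp (r i)
  set f' : (ι → ℝ) → (ι → ℝ) →L[ℝ] (ι → ℝ) := fun r =>
    ContinuousLinearMap.pi fun i => (exp (r i) • ContinuousLinearMap.id ℝ ℝ).comp
      (ContinuousLinearMap.proj i)
  have hf : ∀ r ∈ (Set.univ : Set (ι → ℝ)), HasFDerivWithinAt f (f' r) Set.univ r := by
    intro r _
    refine HasFDerivAt.hasFDerivWithinAt (hasFDerivAt_pi.2 fun i => ?_)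
    have h := (hasDerivAt_exp (r i)).comp_hasFDerivAt r
      (hasFDerivAt_apply (𝕜 := ℝ) (F' := fun _ : ι => ℝ) i r)
    exact h.congr_fderiv (by ext; simp)
  have hinj : Set.InjOn f Set.univ := fun r _ r' _ h =>
    funext fun i => exp_injective (congrFun h i)
  have himg : f '' Set.univ = {u : ι → ℝ | ∀ i, 0 < u i} := by
    ext u
    constructor
    · rintro ⟨r, _, rfl⟩ i
      exact exp_pos _
    · intro hu
      exact ⟨fun i => log (u i), trivial, funext fun i => exp_log (hu i)⟩
  rw [← himg, lintegral_image_eq_lintegral_abs_det_fderiv_mul volume MeasurableSet.univ hf hinj,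
    Measure.restrict_univ]
  refine lintegral_congr fun r => ?_
  congr 2
  rw [ContinuousLinearMap.det_pi]
  have : ∀ i, (exp (r i) • ContinuousLinearMap.id ℝ ℝ).det = exp (r i) := fun i => by
    rw [ContinuousLinearMap.det, LinearMap.det_ring]
    simp
  simp only [this]
  exact abs_of_pos (Finset.prod_pos fun i _ => exp_pos _)

/-- The magic formula: the mixing density integrates to one. -/
theorem lintegral_pinDensity (hG : G.Connected) (x : V) {e0 : Sym2 V}
    (he0 : e0 ∈ G.edgeFinset) {a : Sym2 V → ℝ} (ha : ∀ e ∈ G.edgeFinset, 0 < a e) :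
    ∫⁻ u, pinDensity G e0 x a u = 1 := by
  have hS : MeasurableSet {u : Epin G e0 → ℝ | ∀ e, 0 < u e} := by
    simp only [Set.ofPred_forall]
    exact MeasurableSet.iInter fun e => measurableSet_lt measurable_const (measurable_pi_apply e)
  have hind : (pinDensity G e0 x a) = Set.indicator {u : Epin G e0 → ℝ | ∀ e, 0 < u e}
      (pinDensity G e0 x a) := by
    refine (Set.indicator_eq_self.2 fun u hu => ?_).symm
    by_contra h
    refine hu ?_
    rw [pinDensity, if_neg (fun h' => h ((pinExt_pos_iff u).1 h')), ENNReal.ofReal_zero]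
  have hZ := Znorm_pos hG he0 ha x
  rw [hind, lintegral_indicator hS, lintegral_exp_coord]
  have hpt : ∀ r : Epin G e0 → ℝ, ENNReal.ofReal (∏ e, exp (r e)) *
      pinDensity G e0 x a (fun e => exp (r e)) =
      ENNReal.ofReal (Znorm G x a)⁻¹ *
        ENNReal.ofReal (logKernel G x a (logW G e0 (0, r))) := by
    intro r
    rw [pinDensity, if_pos ((pinExt_pos_iff _).2 fun e => exp_pos _),
      magicDensity_congr fun e he => pinExt_exp r he,
      ← ENNReal.ofReal_mul (Finset.prod_nonneg fun e _ => (exp_pos _).le),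
      ← ENNReal.ofReal_mul (inv_nonneg.2 hZ.le), ← magicDensity_exp hG x he0 _ _ (logW_ref _ _)]
    simp only [logW_coe]
  simp only [hpt]
  rw [lintegral_const_mul' _ _ ENNReal.ofReal_ne_top, lintegral_logKernel hG x he0 ha,
    ← ENNReal.ofReal_mul (inv_nonneg.2 hZ.le), inv_mul_cancel₀ hZ.ne', ENNReal.ofReal_one]

/-! ### Relative entropy of mixing measures -/

theorem log_Znorm (hG : G.Connected) {e0 : Sym2 V} (he0 : e0 ∈ G.edgeFinset) {a : Sym2 V → ℝ}
    (ha : ∀ e ∈ G.edgeFinset, 0 < a e) (x : V) :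
    log (Znorm G x a) = ∑ e ∈ G.edgeFinset, log (Gamma (a e)) -
      ∑ v, log (Gamma (bwt G x a v)) + ((Fintype.card V : ℝ) - 1) / 2 * log π -
      (1 - (Fintype.card V : ℝ) + ∑ e ∈ G.edgeFinset, a e) * log 2 := by
  have h1 : ∀ e ∈ G.edgeFinset, Gamma (a e) ≠ 0 := fun e he => (Gamma_pos_of_pos (ha e he)).ne'
  have h2 : ∀ v ∈ Finset.univ, Gamma (bwt G x a v) ≠ 0 := fun v _ =>
    (Gamma_pos_of_pos (bwt_pos hG he0 ha x v)).ne'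
  have h1' := Finset.prod_ne_zero_iff.2 h1
  have h2' := Finset.prod_ne_zero_iff.2 h2
  have hp := (rpow_pos_of_pos pi_pos (((Fintype.card V : ℝ) - 1) / 2)).ne'
  have ht := (rpow_pos_of_pos (two_pos (α := ℝ))
    (1 - (Fintype.card V : ℝ) + ∑ e ∈ G.edgeFinset, a e)).ne'
  rw [Znorm, log_div (mul_ne_zero (div_ne_zero h1' h2') hp) ht,
    log_mul (div_ne_zero h1' h2') hp, log_div h1' h2', log_prod h1, log_prod h2,
    log_rpow pi_pos, log_rpow two_pos]

theorem hasDerivAt_log_Gamma {p : ℝ} (hp : 0 < p) :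
    HasDerivAt (fun y => log (Gamma y)) (digamma p) p := by
  refine DifferentiableAt.hasDerivAt ?_
  refine DifferentiableAt.log (differentiableAt_Gamma fun m => ?_) (Gamma_pos_of_pos hp).ne'
  have := m.cast_nonneg (α := ℝ)
  linarith

variable (G) in
/-- Logarithmic likelihood ratio of mixing measures, up to normalization. -/
def logRatio (δ w : Sym2 V → ℝ) : ℝ :=
  ∑ e ∈ G.edgeFinset, δ e * log (w e) - ∑ v, vw G δ v / 2 * log (vw G w v)

theorem vw_add (a b : Sym2 V → ℝ) (v : V) : vw G (fun e => a e + b e) v = vw G a v + vw G b v :=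
  Finset.sum_add_distrib

theorem vw_sub (a b : Sym2 V → ℝ) (v : V) : vw G (fun e => a e - b e) v = vw G a v - vw G b v :=
  Finset.sum_sub_distrib ..

theorem logRatio_smul (s : ℝ) (δ w : Sym2 V → ℝ) :
    logRatio G (fun e => s * δ e) w = s * logRatio G δ w := by
  simp only [logRatio, vw_smul, mul_sub, Finset.mul_sum]
  congr 1 <;> exact Finset.sum_congr rfl fun _ _ => by ring

theorem magicDensity_ratio (hG : G.Connected) {e0 : Sym2 V} (he0 : e0 ∈ G.edgeFinset)
    {a b w : Sym2 V → ℝ} (hb : ∀ e ∈ G.edgeFinset, 0 < b e)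
    (hw : ∀ e ∈ G.edgeFinset, 0 < w e) (x : V) :
    magicDensity G x a w =
      Znorm G x b / Znorm G x a * exp (logRatio G (fun e => a e - b e) w) *
        magicDensity G x b w := by
  have hwv := vw_pos hG he0 hw
  have hZ := Znorm_pos hG he0 hb x
  have h1 : ∏ e ∈ G.edgeFinset, w e ^ (a e - 1) =
      exp (∑ e ∈ G.edgeFinset, (a e - b e) * log (w e)) * ∏ e ∈ G.edgeFinset, w e ^ (b e - 1) := by
    rw [exp_sum, ← Finset.prod_mul_distrib]
    refine Finset.prod_congr rfl fun e he => ?_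
    rw [mul_comm (a e - b e), ← rpow_def_of_pos (hw e he), ← rpow_add (hw e he)]
    congr 1
    ring
  have h2 : (∏ v, vw G w v ^ ((vw G a v + 1) / 2)) =
      exp (∑ v, vw G (fun e => a e - b e) v / 2 * log (vw G w v)) *
        ∏ v, vw G w v ^ ((vw G b v + 1) / 2) := by
    rw [exp_sum, ← Finset.prod_mul_distrib]
    refine Finset.prod_congr rfl fun v _ => ?_
    rw [mul_comm (_ / 2) (log _), ← rpow_def_of_pos (hwv v), ← rpow_add (hwv v), vw_sub]
    congr 1
    ring
  have h3 : 0 < ∏ v, vw G w v ^ ((vw G b v + 1) / 2) :=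
    Finset.prod_pos fun v _ => rpow_pos_of_pos (hwv v) _
  rw [magicDensity, magicDensity, h1, h2, logRatio, exp_sub]
  field_simp

theorem measurable_pinExt (e0 : Sym2 V) : Measurable (pinExt G e0) := by
  refine measurable_pi_lambda _ fun e => ?_
  unfold pinExt
  split_ifs <;> fun_prop

theorem measurable_logRatio (δ : Sym2 V → ℝ) : Measurable (logRatio G δ) := by
  unfold logRatio vw
  fun_prop

theorem measurable_pinDensity (e0 : Sym2 V) (x : V) (a : Sym2 V → ℝ) :
    Measurable (pinDensity G e0 x a) := by
  have hS : MeasurableSet {u : Epin G e0 → ℝ | ∀ e ∈ G.edgeFinset, 0 < pinExt G e0 u e} := by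
    simp only [Set.ofPred_forall]
    exact MeasurableSet.iInter fun e => MeasurableSet.iInter fun _ =>
      measurableSet_lt measurable_const ((measurable_pi_apply e).comp (measurable_pinExt e0))
  have h : Measurable (magicDensity G x a) := by
    unfold magicDensity vw tau
    fun_prop
  exact (Measurable.ite hS (h.comp (measurable_pinExt e0)) measurable_const).ennreal_ofReal

theorem mixing_eq (e0 : Sym2 V) (x : V) (a : Sym2 V → ℝ) :
    mixing G e0 x a = Measure.map (pinExt G e0) (volume.withDensity (pinDensity G e0 x a)) :=
  rfl

theorem isProbabilityMeasure_mixing (hG : G.Connected) (x : V) {e0 : Sym2 V}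
    (he0 : e0 ∈ G.edgeFinset) {a : Sym2 V → ℝ} (ha : ∀ e ∈ G.edgeFinset, 0 < a e) :
    IsProbabilityMeasure (mixing G e0 x a) := by
  constructor
  rw [mixing_eq, Measure.map_apply (measurable_pinExt e0) MeasurableSet.univ, Set.preimage_univ,
    withDensity_apply _ MeasurableSet.univ, Measure.restrict_univ, lintegral_pinDensity hG x he0 ha]

theorem mixing_eq_withDensity (hG : G.Connected) (x : V) {e0 : Sym2 V} (he0 : e0 ∈ G.edgeFinset)
    {a b : Sym2 V → ℝ} (ha : ∀ e ∈ G.edgeFinset, 0 < a e) (hb : ∀ e ∈ G.edgeFinset, 0 < b e) :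
    mixing G e0 x a = (mixing G e0 x b).withDensity fun w =>
      ENNReal.ofReal (Znorm G x b / Znorm G x a * exp (logRatio G (fun e => a e - b e) w)) := by
  have hZ : 0 < Znorm G x b / Znorm G x a :=
    div_pos (Znorm_pos hG he0 hb x) (Znorm_pos hG he0 ha x)
  have hg : Measurable fun w =>
      ENNReal.ofReal (Znorm G x b / Znorm G x a * exp (logRatio G (fun e => a e - b e) w)) := by
    have := measurable_logRatio (G := G) fun e => a e - b e
    fun_prop
  have hp := measurable_pinExt (G := G) e0
  ext s hs
  rw [withDensity_apply _ hs, mixing_eq, mixing_eq, setLIntegral_map hs hg hp,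
    Measure.map_apply hp hs, withDensity_apply _ (hp hs),
    setLIntegral_withDensity_eq_setLIntegral_mul _ (measurable_pinDensity e0 x b)
      (g := fun u => ENNReal.ofReal (Znorm G x b / Znorm G x a *
        exp (logRatio G (fun e => a e - b e) (pinExt G e0 u)))) (hg.comp hp) (hp hs)]
  refine lintegral_congr fun u => ?_
  simp only [Pi.mul_apply, pinDensity]
  split_ifs with h
  · rw [← ENNReal.ofReal_mul' (by positivity), magicDensity_ratio hG he0 hb h, mul_comm]
  · simp

theorem lintegral_exp_logRatio (hG : G.Connected) (x : V) {e0 : Sym2 V} (he0 : e0 ∈ G.edgeFinset)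
    {a δ : Sym2 V → ℝ} (ha : ∀ e ∈ G.edgeFinset, 0 < a e) {s : ℝ}
    (hs : ∀ e ∈ G.edgeFinset, 0 < a e + s * δ e) :
    ∫⁻ w, ENNReal.ofReal (exp (s * logRatio G δ w)) ∂mixing G e0 x a =
      ENNReal.ofReal (Znorm G x (fun e => a e + s * δ e) / Znorm G x a) := by
  have h := mixing_eq_withDensity hG x he0 hs ha
  have hpr := isProbabilityMeasure_mixing hG x he0 hs
  have h1 := hpr.measure_univ
  have hZ := Znorm_pos hG he0 ha x
  have hZ' := Znorm_pos hG he0 hs x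
  rw [h, withDensity_apply _ MeasurableSet.univ, Measure.restrict_univ] at h1
  simp only [add_sub_cancel_left, logRatio_smul, ENNReal.ofReal_mul (div_pos hZ hZ').le] at h1
  rw [lintegral_const_mul' _ _ ENNReal.ofReal_ne_top] at h1
  rw [ENNReal.eq_inv_of_mul_eq_one_left ((mul_comm _ _).trans h1),
    ← ENNReal.ofReal_inv_of_pos (div_pos hZ hZ'), inv_div]

theorem integral_logRatio (hG : G.Connected) (x : V) {e0 : Sym2 V} (he0 : e0 ∈ G.edgeFinset)
    {a : Sym2 V → ℝ} (ha : ∀ e ∈ G.edgeFinset, 0 < a e) (δ : Sym2 V → ℝ) :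
    Integrable (logRatio G δ) (mixing G e0 x a) ∧
      ∫ w, logRatio G δ w ∂mixing G e0 x a =
        ∑ e ∈ G.edgeFinset, δ e * digamma (a e) - ∑ v, vw G δ v / 2 * digamma (bwt G x a v) -
          (∑ e ∈ G.edgeFinset, δ e) * log 2 := by
  have := isProbabilityMeasure_mixing hG x he0 ha
  have hnear : ∀ᶠ s : ℝ in nhds 0, ∀ e ∈ G.edgeFinset, 0 < a e + s * δ e := by
    rw [Finset.eventually_all]
    intro e he
    have hc : ContinuousAt (fun s : ℝ => a e + s * δ e) 0 := by fun_prop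
    exact hc.eventually_const_lt (by simpa using ha e he)
  have hint : ∀ s : ℝ, (∀ e ∈ G.edgeFinset, 0 < a e + s * δ e) →
      Integrable (fun w => exp (s * logRatio G δ w)) (mixing G e0 x a) := by
    intro s hs
    have hm : Measurable fun w => exp (s * logRatio G δ w) :=
      ((measurable_logRatio δ).const_mul s).exp
    refine ⟨hm.aestronglyMeasurable, ?_⟩
    rw [hasFiniteIntegral_iff_ofReal (Eventually.of_forall fun w => (exp_pos _).le),
      lintegral_exp_logRatio hG x he0 ha hs]
    exact ENNReal.ofReal_lt_top
  have hmem : (0 : ℝ) ∈ interior (ProbabilityTheory.integrableExpSet (logRatio G δ)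
      (mixing G e0 x a)) := by
    rw [mem_interior_iff_mem_nhds]
    filter_upwards [hnear] with s hs using hint s hs
  refine ⟨ProbabilityTheory.integrable_of_mem_interior_integrableExpSet hmem, ?_⟩
  have hmgf : ProbabilityTheory.mgf (logRatio G δ) (mixing G e0 x a) =ᶠ[nhds 0] fun s =>
      exp (log (Znorm G x (fun e => a e + s * δ e)) - log (Znorm G x a)) := by
    filter_upwards [hnear] with s hs
    rw [exp_sub, exp_log (Znorm_pos hG he0 hs x), exp_log (Znorm_pos hG he0 ha x),
      ProbabilityTheory.mgf, integral_eq_lintegral_of_nonneg_ae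
        (Eventually.of_forall fun w => (exp_pos _).le) (hint s hs).1,
      lintegral_exp_logRatio hG x he0 ha hs, ENNReal.toReal_ofReal]
    exact (div_pos (Znorm_pos hG he0 hs x) (Znorm_pos hG he0 ha x)).le
  rw [← ProbabilityTheory.deriv_mgf_zero hmem]
  refine HasDerivAt.deriv ?_
  refine HasDerivAt.congr_of_eventuallyEq ?_ hmgf
  have hlog : (fun s => log (Znorm G x (fun e => a e + s * δ e))) =ᶠ[nhds 0] fun s =>
      ∑ e ∈ G.edgeFinset, log (Gamma (a e + s * δ e)) -
      ∑ v, log (Gamma (bwt G x a v + s * (vw G δ v / 2))) +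
        ((Fintype.card V : ℝ) - 1) / 2 * log π -
      (1 - (Fintype.card V : ℝ) + ∑ e ∈ G.edgeFinset, (a e + s * δ e)) * log 2 := by
    filter_upwards [hnear] with s hs
    rw [log_Znorm hG he0 hs]
    have hb : ∀ v, bwt G x (fun e => a e + s * δ e) v = bwt G x a v + s * (vw G δ v / 2) := by
      intro v
      rw [bwt, bwt, vw_add, vw_smul]
      ring
    simp only [hb]
  have hlin : ∀ p c : ℝ, HasDerivAt (fun s : ℝ => p + s * c) c 0 := fun p c => by
    simpa using ((hasDerivAt_id (0 : ℝ)).mul_const c).const_add p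
  have hΓ : ∀ p c : ℝ, 0 < p →
      HasDerivAt (fun s : ℝ => log (Gamma (p + s * c))) (c * digamma p) 0 := by
    intro p c hp
    have h1 : HasDerivAt (fun y => log (Gamma y)) (digamma p) (p + 0 * c) := by
      simpa using hasDerivAt_log_Gamma hp
    rw [mul_comm]
    exact h1.comp 0 (hlin p c)
  have hE := HasDerivAt.fun_sum fun e (he : e ∈ G.edgeFinset) => hΓ (a e) (δ e) (ha e he)
  have hV := HasDerivAt.fun_sum fun v (_ : v ∈ Finset.univ) =>
    hΓ (bwt G x a v) (vw G δ v / 2) (bwt_pos hG he0 ha x v)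
  have hL := HasDerivAt.fun_sum fun e (_ : e ∈ G.edgeFinset) => hlin (a e) (δ e)
  have hall := (((hE.sub hV).add_const (((Fintype.card V : ℝ) - 1) / 2 * log π)).sub
    ((hL.const_add (1 - (Fintype.card V : ℝ))).mul_const (log 2)))
  have hd := (hall.congr_of_eventuallyEq hlog).sub_const (log (Znorm G x a))
  refine (hd.exp).congr_deriv ?_
  simp

variable (G) in
/-- Relative entropy of mixing measures in closed form. -/
def mixingEntropy (x : V) (a b : Sym2 V → ℝ) : ℝ :=
  ∑ e ∈ G.edgeFinset, Lam (a e) (b e) - ∑ v, Lam (bwt G x a v) (bwt G x b v)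

theorem KL_withDensity {Ω : Type*} [MeasurableSpace Ω] (ν : Measure Ω) [SigmaFinite ν]
    {g : Ω → ℝ≥0∞} (hg : Measurable g) :
    KL (ν.withDensity g) ν = ((∫ ω, log (g ω).toReal ∂ν.withDensity g : ℝ) : EReal) := by
  have hac := withDensity_absolutelyContinuous ν g
  rw [KL, if_pos hac]
  congr 1
  refine integral_congr_ae ?_
  filter_upwards [hac.ae_le (Measure.rnDeriv_withDensity ν hg)] with ω hω
  rw [hω]

theorem KL_mixing (hG : G.Connected) (x : V) {e0 : Sym2 V} (he0 : e0 ∈ G.edgeFinset)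
    {a b : Sym2 V → ℝ} (ha : ∀ e ∈ G.edgeFinset, 0 < a e) (hb : ∀ e ∈ G.edgeFinset, 0 < b e) :
    KL (mixing G e0 x a) (mixing G e0 x b) = (mixingEntropy G x a b : EReal) := by
  have := isProbabilityMeasure_mixing hG x he0 ha
  have := isProbabilityMeasure_mixing hG x he0 hb
  have hZa := Znorm_pos hG he0 ha x
  have hZb := Znorm_pos hG he0 hb x
  set g : (Sym2 V → ℝ) → ℝ≥0∞ := fun w =>
    ENNReal.ofReal (Znorm G x b / Znorm G x a * exp (logRatio G (fun e => a e - b e) w)) with hg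
  have hgm : Measurable g := by
    have := measurable_logRatio (G := G) fun e => a e - b e
    fun_prop
  have h : mixing G e0 x a = (mixing G e0 x b).withDensity g := mixing_eq_withDensity hG x he0 ha hb
  have hlog : ∀ w, log (g w).toReal = (log (Znorm G x b) - log (Znorm G x a)) +
      logRatio G (fun e => a e - b e) w := by
    intro w
    rw [hg, ENNReal.toReal_ofReal (by positivity), log_mul (by positivity) (exp_pos _).ne', log_exp,
      log_div hZb.ne' hZa.ne']
  obtain ⟨hi, hv⟩ := integral_logRatio hG x he0 ha fun e => a e - b e
  have hKL := KL_withDensity (mixing G e0 x b) hgm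
  rw [← h] at hKL
  rw [hKL]
  congr 1
  simp only [hlog]
  rw [integral_add (integrable_const _) hi, hv, integral_const, probReal_univ, one_smul,
    log_Znorm hG he0 ha, log_Znorm hG he0 hb, mixingEntropy]
  have hbw : ∀ v, vw G (fun e => a e - b e) v / 2 = bwt G x a v - bwt G x b v := fun v => by
    rw [vw_sub, bwt, bwt]
    ring
  simp only [hbw, Lam, Finset.sum_sub_distrib, sub_mul]
  ring

/-! ### Relative entropy of discrete measures -/

theorem lintegral_discreteMeasure {Ω : Type*} [Fintype Ω] [MeasurableSpace Ω]
    [DiscreteMeasurableSpace Ω] (p : Ω → ℝ) (f : Ω → ℝ≥0∞) :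
    ∫⁻ ω, f ω ∂discreteMeasure p = ∑ ω, ENNReal.ofReal (p ω) * f ω := by
  rw [discreteMeasure, lintegral_finsetSum_measure]
  simp [lintegral_smul_measure]

theorem integral_discreteMeasure {Ω : Type*} [Fintype Ω] [MeasurableSpace Ω]
    [DiscreteMeasurableSpace Ω] {p : Ω → ℝ} (hp : ∀ ω, 0 ≤ p ω) (f : Ω → ℝ) :
    ∫ ω, f ω ∂discreteMeasure p = ∑ ω, p ω * f ω := by
  rw [discreteMeasure, integral_finsetSum_measure fun ω _ =>
    (integrable_dirac (by simp)).smul_measure ENNReal.ofReal_ne_top]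
  refine Finset.sum_congr rfl fun ω _ => ?_
  rw [integral_smul_measure, integral_dirac, ENNReal.toReal_ofReal (hp ω), smul_eq_mul]

theorem KL_discreteMeasure {Ω : Type*} [Fintype Ω] [MeasurableSpace Ω]
    [DiscreteMeasurableSpace Ω] {p q : Ω → ℝ} (hp : ∀ ω, 0 ≤ p ω) (hq : ∀ ω, 0 ≤ q ω)
    (hpq : ∀ ω, q ω = 0 → p ω = 0) :
    KL (discreteMeasure p) (discreteMeasure q) =
      ((∑ ω, p ω * log (p ω / q ω) : ℝ) : EReal) := by
  have : IsFiniteMeasure (discreteMeasure q) := by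
    refine ⟨?_⟩
    rw [← lintegral_one, lintegral_discreteMeasure]
    simp [ENNReal.sum_lt_top]
  have h : discreteMeasure p = (discreteMeasure q).withDensity fun ω =>
      ENNReal.ofReal (p ω / q ω) := by
    ext s hs
    rw [withDensity_apply _ hs, ← lintegral_indicator hs, ← lintegral_indicator_one hs,
      lintegral_discreteMeasure, lintegral_discreteMeasure]
    refine Finset.sum_congr rfl fun ω _ => ?_
    by_cases hω : ω ∈ s
    · rw [Set.indicator_of_mem hω, Set.indicator_of_mem hω, ← ENNReal.ofReal_mul (hq ω),
        Pi.one_apply, mul_one]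
      congr 1
      by_cases h0 : q ω = 0
      · rw [hpq ω h0, h0, zero_mul]
      · rw [mul_div_cancel₀ _ h0]
    · rw [Set.indicator_of_notMem hω, Set.indicator_of_notMem hω, mul_zero, mul_zero]
  have hKL := KL_withDensity (discreteMeasure q) (g := fun ω => ENNReal.ofReal (p ω / q ω))
    (measurable_of_countable _)
  rw [← h] at hKL
  rw [hKL, integral_discreteMeasure hp]
  congr 1
  refine Finset.sum_congr rfl fun ω _ => ?_
  rw [ENNReal.toReal_ofReal (div_nonneg (hp ω) (hq ω))]

/-! ### The one-step entropy identity -/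

theorem digamma_add_one {p : ℝ} (hp : 0 < p) : digamma (p + 1) = digamma p + 1 / p := by
  have h1 : HasDerivAt (fun y => log (Gamma (y + 1))) (digamma (p + 1)) p := by
    simpa using (hasDerivAt_log_Gamma (add_pos hp one_pos)).comp_add_const p 1
  have h2 : HasDerivAt (fun y => log (Gamma y) + log y) (digamma p + 1 / p) p := by
    rw [one_div]
    exact (hasDerivAt_log_Gamma hp).fun_add (hasDerivAt_log hp.ne')
  refine h1.unique (h2.congr_of_eventuallyEq ?_)
  filter_upwards [lt_mem_nhds hp] with y hy
  rw [Gamma_add_one hy.ne', log_mul hy.ne' (Gamma_pos_of_pos hy).ne', add_comm]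

theorem Lam_add_one {p q : ℝ} (hp : 0 < p) (hq : 0 < q) :
    Lam (p + 1) (q + 1) = Lam p q + (log (q / p) - (q / p - 1)) := by
  rw [Lam, Lam, digamma_add_one hp, Gamma_add_one hp.ne', Gamma_add_one hq.ne',
    log_mul hp.ne' (Gamma_pos_of_pos hp).ne', log_mul hq.ne' (Gamma_pos_of_pos hq).ne',
    log_div hq.ne' hp.ne']
  field_simp
  ring

theorem vw_single {z y : V} (hzy : G.Adj z y) (v : V) :
    vw G (fun e => if s(z, y) = e then 1 else 0) v =
      (if v = z then 1 else 0) + if v = y then 1 else 0 := by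
  have hne := hzy.ne
  by_cases hvz : v = z
  · subst hvz
    rw [vw, if_pos rfl, if_neg hne, add_zero, Finset.sum_eq_single y]
    · simp
    · intro j _ hj
      rw [if_neg]
      simp only [Sym2.eq_iff, not_or, not_and]
      exact ⟨fun _ h => hj h.symm, fun _ h => hne h.symm⟩
    · intro h
      exact absurd (by simpa using hzy) h
  · by_cases hvy : v = y
    · subst hvy
      rw [vw, if_neg hvz, if_pos rfl, zero_add, Finset.sum_eq_single z]
      · simp [Sym2.eq_swap]
      · intro j _ hj
        rw [if_neg]
        simp [Ne.symm hvz, hj.symm]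
      · intro h
        exact absurd (by simpa using hzy.symm) h
    · rw [vw, if_neg hvz, if_neg hvy, add_zero]
      refine Finset.sum_eq_zero fun j _ => ?_
      rw [if_neg]
      simp [Ne.symm hvz, Ne.symm hvy]

theorem bwt_step {z y : V} (hzy : G.Adj z y) (a : Sym2 V → ℝ) (v : V) :
    bwt G y (fun e => a e + if s(z, y) = e then 1 else 0) v =
      bwt G z a v + if v = z then 1 else 0 := by
  rw [bwt, bwt, vw_add, vw_single hzy]
  split_ifs <;> ring

theorem mixingEntropy_step (hG : G.Connected) {e0 : Sym2 V} (he0 : e0 ∈ G.edgeFinset)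
    {a b : Sym2 V → ℝ} (ha : ∀ e ∈ G.edgeFinset, 0 < a e) (hb : ∀ e ∈ G.edgeFinset, 0 < b e)
    {z y : V} (hzy : G.Adj z y) :
    mixingEntropy G y (fun e => a e + if s(z, y) = e then 1 else 0)
        (fun e => b e + if s(z, y) = e then 1 else 0) =
      mixingEntropy G z a b +
        (log (b s(z, y) / a s(z, y)) - (b s(z, y) / a s(z, y) - 1)) -
        (log (vw G b z / vw G a z) - (vw G b z / vw G a z - 1)) := by
  have hmem : s(z, y) ∈ G.edgeFinset := by simpa using hzy
  have hE : ∀ e ∈ G.edgeFinset, Lam (a e + if s(z, y) = e then 1 else 0)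
      (b e + if s(z, y) = e then 1 else 0) = Lam (a e) (b e) +
        if s(z, y) = e then log (b e / a e) - (b e / a e - 1) else 0 := by
    intro e he
    split_ifs
    · exact Lam_add_one (ha e he) (hb e he)
    · simp
  have hV : ∀ v ∈ Finset.univ, Lam (bwt G z a v + if v = z then 1 else 0)
      (bwt G z b v + if v = z then 1 else 0) = Lam (bwt G z a v) (bwt G z b v) +
        if v = z then log (vw G b z / vw G a z) - (vw G b z / vw G a z - 1) else 0 := by
    intro v _
    split_ifs with h
    · subst h
      rw [Lam_add_one (bwt_pos hG he0 ha v v) (bwt_pos hG he0 hb v v), bwt_self, bwt_self,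
        div_div_div_cancel_right₀ two_ne_zero]
    · simp
  simp only [mixingEntropy, bwt_step hzy]
  rw [Finset.sum_congr rfl hE, Finset.sum_congr rfl hV, Finset.sum_add_distrib,
    Finset.sum_add_distrib, Finset.sum_ite_eq, Finset.sum_ite_eq', if_pos hmem,
    if_pos (Finset.mem_univ z)]
  ring

/-! ### The chain rule along trajectories -/

theorem extendPath_snoc_of_le (v0 : V) {T t : ℕ} (x : Fin (T + 1) → V) (y : V) (ht : t ≤ T) :
    extendPath v0 (Fin.snoc x y : Fin (T + 1 + 1) → V) t = extendPath v0 x t := by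
  have h1 : t < T + 1 := Nat.lt_succ_of_le ht
  rw [extendPath, extendPath, dif_pos h1, dif_pos (h1.trans (Nat.lt_succ_self _))]
  exact Fin.snoc_castSucc (α := fun _ => V) y x ⟨t, h1⟩

theorem extendPath_last (v0 : V) {T : ℕ} (x : Fin (T + 1) → V) :
    extendPath v0 x T = x (Fin.last T) :=
  dif_pos (Nat.lt_succ_self T)

theorem edgeCount_snoc (v0 : V) {T : ℕ} (x : Fin (T + 1) → V) (y : V) (e : Sym2 V) :
    edgeCount v0 (Fin.snoc x y : Fin (T + 1 + 1) → V) e =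
      edgeCount v0 x e + if s(x (Fin.last T), y) = e then 1 else 0 := by
  have h : ∀ k ∈ Finset.range T,
      s(extendPath v0 (Fin.snoc x y : Fin (T + 1 + 1) → V) k,
        extendPath v0 (Fin.snoc x y : Fin (T + 1 + 1) → V) (k + 1)) =
      s(extendPath v0 x k, extendPath v0 x (k + 1)) := fun k hk => by
    have := Finset.mem_range.1 hk
    rw [extendPath_snoc_of_le _ _ _ this.le, extendPath_snoc_of_le _ _ _ this]
  simp only [edgeCount, Finset.card_filter]
  rw [Finset.sum_range_succ, extendPath_snoc_of_le _ _ _ le_rfl, extendPath_last,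
    extendPath_last, Fin.snoc_last]
  congr 1
  exact Finset.sum_congr rfl fun k hk => by rw [h k hk]

theorem localTime_congr (a : Sym2 V → ℝ) {x y : ℕ → V} {t : ℕ} (h : ∀ k ≤ t, x k = y k)
    (e : Sym2 V) : localTime a x t e = localTime a y t e := by
  rw [localTime, localTime]
  congr 3
  refine Finset.filter_congr fun k hk => ?_
  have := Finset.mem_range.1 hk
  rw [h k this.le, h (k + 1) this]

theorem errwStep_congr (a : Sym2 V → ℝ) {x y : ℕ → V} {t : ℕ} (h : ∀ k ≤ t + 1, x k = y k) :
    errwStep G a x t = errwStep G a y t := by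
  have h' : ∀ k ≤ t, x k = y k := fun k hk => h k (hk.trans (Nat.le_succ t))
  rw [errwStep, errwStep, h' t le_rfl, h (t + 1) le_rfl]
  simp only [localTime_congr a h']

theorem errwProb_snoc (v0 : V) (a : Sym2 V → ℝ) {T : ℕ} (x : Fin (T + 1) → V) (y : V) :
    errwProb G v0 a (T + 1) (Fin.snoc x y : Fin (T + 1 + 1) → V) =
      errwProb G v0 a T x *
        qstep G (fun e => a e + edgeCount v0 x e) (x (Fin.last T)) y := by
  have h0 : (Fin.snoc x y : Fin (T + 1 + 1) → V) 0 = x 0 :=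
    Fin.snoc_castSucc (α := fun _ => V) y x 0
  have h1 : ∀ t ∈ Finset.range T,
      errwStep G a (extendPath v0 (Fin.snoc x y : Fin (T + 1 + 1) → V)) t =
        errwStep G a (extendPath v0 x) t := fun t ht =>
    errwStep_congr a fun k hk =>
      extendPath_snoc_of_le v0 x y (hk.trans (Finset.mem_range.1 ht))
  have h2 : errwStep G a (extendPath v0 (Fin.snoc x y : Fin (T + 1 + 1) → V)) T =
      qstep G (fun e => a e + edgeCount v0 x e) (x (Fin.last T)) y := by
    simp only [errwStep, localTime_congr a fun k hk => extendPath_snoc_of_le v0 x y hk]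
    rw [extendPath_snoc_of_le v0 x y le_rfl, extendPath_last, extendPath_last, Fin.snoc_last]
    rfl
  rw [errwProb, errwProb, h0, Finset.prod_range_succ, Finset.prod_congr rfl h1, h2, ite_mul,
    zero_mul]

theorem sum_qstep (w : Sym2 V → ℝ) (z : V) (f : V → ℝ) :
    ∑ y, qstep G w z y * f y = ∑ y ∈ G.neighborFinset z, w s(z, y) / vw G w z * f y := by
  simp only [qstep, ite_mul, zero_mul]
  rw [← Finset.sum_filter]
  congr 1
  ext y
  simp

theorem qstep_nonneg (hG : G.Connected) {e0 : Sym2 V} (he0 : e0 ∈ G.edgeFinset)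
    {w : Sym2 V → ℝ} (hw : ∀ e ∈ G.edgeFinset, 0 < w e) (z y : V) : 0 ≤ qstep G w z y := by
  rw [qstep]
  split_ifs with h
  · exact (div_pos (hw _ (by simpa using h)) (vw_pos hG he0 hw z)).le
  · exact le_rfl

theorem qstep_eq_zero_iff (hG : G.Connected) {e0 : Sym2 V} (he0 : e0 ∈ G.edgeFinset)
    {w : Sym2 V → ℝ} (hw : ∀ e ∈ G.edgeFinset, 0 < w e) (z y : V) :
    qstep G w z y = 0 ↔ ¬G.Adj z y := by
  rw [qstep]
  split_ifs with h
  · simpa [h] using (div_pos (hw _ (by simpa using h)) (vw_pos hG he0 hw z)).ne'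
  · simpa using h

theorem add_edgeCount_pos {a : Sym2 V → ℝ} (ha : ∀ e ∈ G.edgeFinset, 0 < a e) (v0 : V) {T : ℕ}
    (x : Fin (T + 1) → V) : ∀ e ∈ G.edgeFinset, 0 < a e + (edgeCount v0 x e : ℝ) :=
  fun e he => add_pos_of_pos_of_nonneg (ha e he) (Nat.cast_nonneg _)

theorem exists_snoc {T : ℕ} (x : Fin (T + 1 + 1) → V) :
    ∃ (x' : Fin (T + 1) → V) (y : V), x = Fin.snoc x' y :=
  ⟨Fin.init x, x (Fin.last _), (Fin.snoc_init_self x).symm⟩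

theorem errwProb_nonneg (hG : G.Connected) {e0 : Sym2 V} (he0 : e0 ∈ G.edgeFinset)
    {a : Sym2 V → ℝ} (ha : ∀ e ∈ G.edgeFinset, 0 < a e) (v0 : V) {T : ℕ}
    (x : Fin (T + 1) → V) : 0 ≤ errwProb G v0 a T x := by
  induction T with
  | zero => rw [errwProb]; split_ifs <;> simp
  | succ T ih =>
    obtain ⟨x, y, rfl⟩ := exists_snoc x
    rw [errwProb_snoc]
    exact mul_nonneg (ih x) (qstep_nonneg hG he0 (add_edgeCount_pos ha v0 x) _ _)

theorem errwProb_eq_zero_iff (hG : G.Connected) {e0 : Sym2 V} (he0 : e0 ∈ G.edgeFinset)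
    {a b : Sym2 V → ℝ} (ha : ∀ e ∈ G.edgeFinset, 0 < a e) (hb : ∀ e ∈ G.edgeFinset, 0 < b e)
    (v0 : V) {T : ℕ} (x : Fin (T + 1) → V) :
    errwProb G v0 b T x = 0 ↔ errwProb G v0 a T x = 0 := by
  induction T with
  | zero => rw [errwProb, errwProb]; simp
  | succ T ih =>
    obtain ⟨x, y, rfl⟩ := exists_snoc x
    rw [errwProb_snoc, errwProb_snoc, mul_eq_zero, mul_eq_zero, ih x,
      qstep_eq_zero_iff hG he0 (add_edgeCount_pos ha v0 x),
      qstep_eq_zero_iff hG he0 (add_edgeCount_pos hb v0 x)]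

/-- One-step chain rule: the entropy of a transition plus the expected posterior entropy is the
prior entropy. -/
theorem sum_qstep_mixingEntropy (hG : G.Connected) {e0 : Sym2 V} (he0 : e0 ∈ G.edgeFinset)
    {a b : Sym2 V → ℝ} (ha : ∀ e ∈ G.edgeFinset, 0 < a e) (hb : ∀ e ∈ G.edgeFinset, 0 < b e)
    (z : V) :
    ∑ y, qstep G a z y * (log (qstep G a z y / qstep G b z y) +
      mixingEntropy G y (fun e => a e + if s(z, y) = e then 1 else 0)
        (fun e => b e + if s(z, y) = e then 1 else 0)) = mixingEntropy G z a b := by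
  have hA := vw_pos hG he0 ha z
  have hB := vw_pos hG he0 hb z
  set A := vw G a z with hAdef
  set B := vw G b z with hBdef
  have h : ∀ y ∈ G.neighborFinset z, a s(z, y) / A * (log (qstep G a z y / qstep G b z y) +
      mixingEntropy G y (fun e => a e + if s(z, y) = e then 1 else 0)
        (fun e => b e + if s(z, y) = e then 1 else 0)) =
      a s(z, y) * ((mixingEntropy G z a b + B / A) / A) - b s(z, y) / A := by
    intro y hy
    have hzy : G.Adj z y := by simpa using hy
    have hay := ha s(z, y) (by simpa using hzy)
    have hby := hb s(z, y) (by simpa using hzy)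
    rw [mixingEntropy_step hG he0 ha hb hzy, qstep, qstep, if_pos hzy, if_pos hzy, ← hAdef,
      ← hBdef, log_div (div_pos hay hA).ne' (div_pos hby hB).ne', log_div hay.ne' hA.ne',
      log_div hby.ne' hB.ne', log_div hby.ne' hay.ne', log_div hB.ne' hA.ne']
    field_simp
    ring
  rw [sum_qstep, ← hAdef, Finset.sum_congr rfl h, Finset.sum_sub_distrib, ← Finset.sum_mul,
    ← Finset.sum_div]
  change A * _ - B / A = _
  field_simp
  ring

theorem sum_fin_snoc {T : ℕ} (f : (Fin (T + 1 + 1) → V) → ℝ) :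
    ∑ x, f x = ∑ x : Fin (T + 1) → V, ∑ y, f (Fin.snoc x y) := by
  rw [← (Fin.snocEquiv fun _ : Fin (T + 1 + 1) => V).sum_comp, Fintype.sum_prod_type_right]
  rfl

/-- The chain rule: the entropy of trajectories plus the expected posterior entropy is the
prior entropy. -/
theorem sum_errwProb_mixingEntropy (hG : G.Connected) {e0 : Sym2 V} (he0 : e0 ∈ G.edgeFinset)
    {a b : Sym2 V → ℝ} (ha : ∀ e ∈ G.edgeFinset, 0 < a e) (hb : ∀ e ∈ G.edgeFinset, 0 < b e)
    (v0 : V) (T : ℕ) :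
    ∑ x : Fin (T + 1) → V, errwProb G v0 a T x *
      (log (errwProb G v0 a T x / errwProb G v0 b T x) +
        mixingEntropy G (x (Fin.last T)) (fun e => a e + edgeCount v0 x e)
          (fun e => b e + edgeCount v0 x e)) = mixingEntropy G v0 a b := by
  induction T with
  | zero =>
    rw [← (Equiv.funUnique (Fin 1) V).symm.sum_comp, Finset.sum_eq_single v0]
    · simp [errwProb, edgeCount]
    · intro v _ hv
      simp [errwProb, hv]
    · simp
  | succ T ih =>
    rw [sum_fin_snoc, ← ih]
    refine Finset.sum_congr rfl fun x _ => ?_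
    have hA := add_edgeCount_pos ha v0 x
    have hB := add_edgeCount_pos hb v0 x
    have hsum : ∑ y, qstep G (fun e => a e + edgeCount v0 x e) (x (Fin.last T)) y = 1 := by
      have := sum_qstep (G := G) (fun e => a e + edgeCount v0 x e) (x (Fin.last T)) fun _ => 1
      simp only [mul_one] at this
      rw [this, ← Finset.sum_div]
      exact div_self (vw_pos hG he0 hA _).ne'
    rw [← sum_qstep_mixingEntropy hG he0 hA hB,
      (by rw [← Finset.sum_mul, hsum, one_mul] :
        log (errwProb G v0 a T x / errwProb G v0 b T x) =
          ∑ y, qstep G (fun e => a e + edgeCount v0 x e) (x (Fin.last T)) y *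
            log (errwProb G v0 a T x / errwProb G v0 b T x)),
      ← Finset.sum_add_distrib, Finset.mul_sum]
    refine Finset.sum_congr rfl fun y _ => ?_
    rw [errwProb_snoc, errwProb_snoc, Fin.snoc_last, mul_assoc, ← mul_add]
    by_cases hP : errwProb G v0 a T x = 0
    · simp [hP]
    by_cases hq : qstep G (fun e => a e + edgeCount v0 x e) (x (Fin.last T)) y = 0
    · simp [hq]
    have hP' := (errwProb_eq_zero_iff hG he0 ha hb v0 x).not.2 hP
    have hq' : qstep G (fun e => b e + edgeCount v0 x e) (x (Fin.last T)) y ≠ 0 := by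
      rwa [Ne, qstep_eq_zero_iff hG he0 hB, ← qstep_eq_zero_iff hG he0 hA]
    rw [mul_div_mul_comm, log_mul (div_ne_zero hP hP') (div_ne_zero hq hq'), add_assoc]
    simp only [edgeCount_snoc, Nat.cast_add, Nat.cast_ite, Nat.cast_one, Nat.cast_zero,
      add_assoc]

end Entropy

/-- Posterior-gap identity, explicit form.  With `μ_s = μ_{v0,A⁽ˢ⁾}` and
`P_s^{(T)}` the ERRW trajectory laws, `Gap_T := D(μ_0‖μ_1) − D(P_0^{(T)}‖P_1^{(T)})`
satisfies
`Gap_T = E_{P_0^{(T)}}[ Σ_{e∈E} Λ(a_e⁽⁰⁾+N_e, a_e⁽¹⁾+N_e) − Σ_{v∈V} Λ(b_v^{(0,N)}, b_v^{(1,N)}) ]`,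
where `b_v^{(s,N)} = (a_v⁽ˢ⁾ + d_v(N) + 1 − 𝟙(v = x_T))/2`. -/
theorem gap_explicit_formula
    {V : Type*} [Fintype V] [DecidableEq V] [MeasurableSpace V] [DiscreteMeasurableSpace V]
    (G : SimpleGraph V) [DecidableRel G.Adj] (hG : G.Connected)
    (v0 : V) (e0 : Sym2 V) (he0 : e0 ∈ G.edgeFinset)
    (a0 a1 : Sym2 V → ℝ)
    (ha0 : ∀ e ∈ G.edgeFinset, 0 < a0 e) (ha1 : ∀ e ∈ G.edgeFinset, 0 < a1 e)
    (T : ℕ) (hT : 1 ≤ T) :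
    KL (mixing G e0 v0 a0) (mixing G e0 v0 a1)
      - KL (discreteMeasure (errwProb G v0 a0 T)) (discreteMeasure (errwProb G v0 a1 T))
    = ((∑ x : Fin (T + 1) → V, errwProb G v0 a0 T x *
          ((∑ e ∈ G.edgeFinset,
              Lam (a0 e + (edgeCount v0 x e : ℝ)) (a1 e + (edgeCount v0 x e : ℝ)))
            - ∑ v : V,
                Lam
                  ((vw G a0 v + (∑ j ∈ G.neighborFinset v, (edgeCount v0 x s(v, j) : ℝ))
                      + 1 - if v = x (Fin.last T) then 1 else 0) / 2)
                  ((vw G a1 v + (∑ j ∈ G.neighborFinset v, (edgeCount v0 x s(v, j) : ℝ))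
                      + 1 - if v = x (Fin.last T) then 1 else 0) / 2)) : ℝ) : EReal) := by
  rw [KL_mixing hG v0 he0 ha0 ha1, KL_discreteMeasure (errwProb_nonneg hG he0 ha0 v0)
    (errwProb_nonneg hG he0 ha1 v0) fun x => (errwProb_eq_zero_iff hG he0 ha0 ha1 v0 x).1,
    ← EReal.coe_sub, ← sum_errwProb_mixingEntropy hG he0 ha0 ha1 v0 T, ← Finset.sum_sub_distrib]
  congr 1
  refine Finset.sum_congr rfl fun x _ => ?_
  rw [← mul_sub, add_sub_cancel_left]
  simp only [mixingEntropy, bwt, vw_add]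
  rfl

end ERRW
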